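/- arXiv:1810.04558 — 2 statements merged into one kernel-verified Lean document; each statement's English description precedes it below -/
import Mathlib

section
/- Let k ≥ 2 be an integer and let α_1, …, α_{k−1} ∈ ℝ. Then for Lebesgue-almost all α_k ∈ ℝ we have liminf_{n→∞} n (log n)^k ‖nα_1‖ ⋯ ‖nα_k‖ = 0. -/
open scoped BigOperators
open Filter MeasureTheory

/-- Distance from `x` to the nearest integer. -/
noncomputable def dn (x : ℝ) : ℝ := |x - round x|

/-- The points of `ℝ` within `δ` of a reduced fraction in `[0, 1)` with denominator `n`. -/
def reducedNbhd (n : ℕ) (δ : ℝ) : Set ℝ :=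
  ⋃ a ∈ (Finset.range n).filter n.Coprime, Metric.ball ((a : ℝ) / n) δ

lemma measurableSet_reducedNbhd (n : ℕ) (δ : ℝ) : MeasurableSet (reducedNbhd n δ) :=
  Finset.measurableSet_biUnion _ fun _ _ => measurableSet_ball

lemma reducedNbhd_subset {n : ℕ} {δ : ℝ} (hδ : δ ≤ 1) :
    reducedNbhd n δ ⊆ Metric.ball 0 2 := by
  intro x hx
  simp only [reducedNbhd, Set.mem_iUnion, Finset.mem_filter, Finset.mem_range] at hx
  obtain ⟨a, ⟨ha, -⟩, hx⟩ := hx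
  have h1 : (a : ℝ) / n ≤ 1 := by
    apply div_le_one_of_le₀ _ (by positivity)
    exact_mod_cast ha.le
  have h0 : (0 : ℝ) ≤ (a : ℝ) / n := by positivity
  rw [Metric.mem_ball, Real.dist_eq, abs_lt] at *
  constructor <;> linarith

lemma volume_reducedNbhd_ne_top (n : ℕ) (δ : ℝ) : volume (reducedNbhd n δ) ≠ ⊤ := by
  refine ne_top_of_le_ne_top ?_ (measure_biUnion_finset_le _ _)
  exact (ENNReal.sum_lt_top.2 fun _ _ => measure_ball_lt_top).ne

lemma volume_real_reducedNbhd {n : ℕ} {δ : ℝ} (h0 : 0 ≤ δ) (hδ : n * δ ≤ 1 / 2) :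
    volume.real (reducedNbhd n δ) = n.totient * (2 * δ) := by
  rw [reducedNbhd, measureReal_biUnion_finset]
  · simp [Real.volume_real_ball h0, Nat.totient_eq_card_coprime]
  · intro a ha b hb hab
    have hn : 0 < n := by
      have := Finset.mem_range.1 (Finset.mem_filter.1 ha).1
      omega
    have hn' : (0 : ℝ) < n := by exact_mod_cast hn
    apply Metric.ball_disjoint_ball
    rw [Real.dist_eq, ← sub_div, abs_div, abs_of_pos hn', le_div_iff₀ hn']
    have : (1 : ℝ) ≤ |(a : ℝ) - b| := by
      have : (1 : ℤ) ≤ |(a : ℤ) - b| := Int.one_le_abs (by omega)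
      exact_mod_cast this
    linarith
  · intro _ _
    exact measurableSet_ball

lemma card_coprime_pairs_le {m n : ℕ} (hmn : m ≠ n) (hm : 0 < m) (hn : 0 < n) {H : ℝ}
    (hH : 0 ≤ H) :
    (((((Finset.range m).filter m.Coprime) ×ˢ ((Finset.range n).filter n.Coprime)).filter
      fun p : ℕ × ℕ => |(p.1 : ℝ) * n - p.2 * m| < H).card : ℝ) ≤ 2 * H := by
  obtain ⟨g, m', n', hg, hco, rfl, rfl⟩ := Nat.exists_coprime' (Nat.gcd_pos_of_pos_left n hm)
  have hm' : 0 < m' := Nat.pos_of_mul_pos_right hm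
  have hn' : 0 < n' := Nat.pos_of_mul_pos_right hn
  set K := ⌊H / g⌋
  have hgR : (0 : ℝ) < g := by exact_mod_cast hg
  have hK : 0 ≤ K := Int.floor_nonneg.2 (by positivity)
  have key := Finset.card_le_mul_card_image_of_maps_to
    (s := ((((Finset.range (m' * g)).filter (m' * g).Coprime) ×ˢ
      ((Finset.range (n' * g)).filter (n' * g).Coprime)).filter
      fun p : ℕ × ℕ => |(p.1 : ℝ) * (n' * g : ℕ) - p.2 * (m' * g : ℕ)| < H))
    (f := fun p : ℕ × ℕ => (p.1 : ℤ) * n' - p.2 * m') (t := (Finset.Icc (-K) K).erase 0)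
    ?_ g ?_
  · have hc : ((Finset.Icc (-K) K).erase 0).card = 2 * K.toNat := by
      rw [Finset.card_erase_of_mem (by simp [hK]), Int.card_Icc]
      omega
    rw [hc] at key
    have hKt : (K.toNat : ℝ) = K := by
      have := Int.toNat_of_nonneg hK
      exact_mod_cast this
    calc _ ≤ ((g * (2 * K.toNat) : ℕ) : ℝ) := by exact_mod_cast key
      _ = 2 * (g * K) := by push_cast; rw [hKt]; ring
      _ ≤ 2 * (g * (H / g)) := by gcongr; exact Int.floor_le _
      _ = 2 * H := by field_simp
  · rintro ⟨a, b⟩ hp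
    simp only [Finset.mem_filter, Finset.mem_product, Finset.mem_range] at hp
    obtain ⟨⟨⟨ha, ham⟩, hb, hbn⟩, hp⟩ := hp
    simp only [Finset.mem_erase, Finset.mem_Icc]
    refine ⟨fun h0 => hmn ?_, abs_le.1 (Int.le_floor.2 ?_)⟩
    · have h1 : a * n' = b * m' := by zify; linarith
      have e1 : m' ∣ n' := (Nat.Coprime.coprime_dvd_left (Dvd.intro _ rfl) ham).dvd_of_dvd_mul_left
        (Dvd.intro_left b h1.symm)
      have e2 : n' ∣ m' := (Nat.Coprime.coprime_dvd_left (Dvd.intro _ rfl) hbn).dvd_of_dvd_mul_left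
        (Dvd.intro_left a h1)
      rw [Nat.dvd_antisymm e1 e2]
    · rw [le_div_iff₀ hgR]
      push_cast at hp ⊢
      refine le_trans (le_of_eq ?_) hp.le
      rw [show (a : ℝ) * (n' * g) - b * (m' * g) = (a * n' - b * m') * g by ring, abs_mul,
        abs_of_pos hgR]
  · intro h _
    calc _ ≤ (Finset.range g).card := ?_
      _ = g := Finset.card_range g
    apply Finset.card_le_card_of_injOn (fun p : ℕ × ℕ => p.1 / m')
    · rintro ⟨a, b⟩ hp
      simp only [Finset.coe_filter, Finset.mem_filter, Finset.mem_product, Finset.mem_range,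
        Set.mem_ofPred_eq] at hp
      simp only [Finset.coe_range, Set.mem_Iio]
      rw [Nat.div_lt_iff_lt_mul hm', mul_comm]
      exact hp.1.1.1.1
    · rintro ⟨a, b⟩ hp ⟨a', b'⟩ hp' hab
      simp only [Finset.coe_filter, Set.mem_ofPred_eq] at hp hp'
      have e := hp.2.trans hp'.2.symm
      have hdvd : (m' : ℤ) ∣ (a : ℤ) - a' := by
        have : (m' : ℤ) ∣ ((a : ℤ) - a') * n' := ⟨b - b', by linarith⟩
        exact (Int.isCoprime_iff_gcd_eq_one.2 (by simpa using hco)).dvd_of_dvd_mul_right this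
      have haa : a = a' := by
        simp only at hab
        have hmod : a' ≡ a [MOD m'] := (Nat.modEq_iff_dvd).2 hdvd
        rw [← Nat.div_add_mod a m', ← Nat.div_add_mod a' m', hab, hmod]
      subst haa
      have : (b : ℤ) * m' = b' * m' := by linarith
      have hbb : (b : ℤ) = b' := mul_right_cancel₀ (by exact_mod_cast hm'.ne') this
      simp only [Prod.mk.injEq, true_and]
      exact_mod_cast hbb

lemma volume_real_reducedNbhd_inter_le {m n : ℕ} (hmn : m ≠ n) {δ ε : ℝ}
    (hδ : 0 ≤ δ) (hε : 0 ≤ ε) :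
    volume.real (reducedNbhd m δ ∩ reducedNbhd n ε) ≤ 8 * (m * δ) * (n * ε) := by
  rcases Nat.eq_zero_or_pos m with rfl | hm
  · simp [reducedNbhd]
  rcases Nat.eq_zero_or_pos n with rfl | hn
  · simp [reducedNbhd]
  have hmR : (0 : ℝ) < m := by exact_mod_cast hm
  have hnR : (0 : ℝ) < n := by exact_mod_cast hn
  set P := (((Finset.range m).filter m.Coprime) ×ˢ ((Finset.range n).filter n.Coprime)).filter
      fun p : ℕ × ℕ => |(p.1 : ℝ) * n - p.2 * m| < m * n * (δ + ε)
  have hsub : reducedNbhd m δ ∩ reducedNbhd n ε ⊆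
      ⋃ p ∈ P, (Metric.ball ((p.1 : ℝ) / m) δ ∩ Metric.ball ((p.2 : ℝ) / n) ε) := by
    rintro x ⟨h1, h2⟩
    simp only [reducedNbhd, Set.mem_iUnion, exists_prop] at h1 h2
    obtain ⟨a, ha, hxa⟩ := h1
    obtain ⟨b, hb, hxb⟩ := h2
    simp only [Set.mem_iUnion, exists_prop]
    refine ⟨(a, b), Finset.mem_filter.2 ⟨Finset.mk_mem_product ha hb, ?_⟩, hxa, hxb⟩
    have h3 : |(a : ℝ) / m - b / n| < δ + ε := by
      rw [Metric.mem_ball] at hxa hxb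
      rw [← Real.dist_eq]
      exact (dist_triangle_left _ _ x).trans_lt (add_lt_add hxa hxb)
    have h4 : (a : ℝ) * n - b * m = m * n * (a / m - b / n) := by field_simp
    simp only
    rw [h4, abs_mul, abs_of_pos (mul_pos hmR hnR)]
    gcongr
  have hfin : volume (⋃ p ∈ P, (Metric.ball ((p.1 : ℝ) / m) δ ∩ Metric.ball ((p.2 : ℝ) / n) ε))
      ≠ ⊤ := by
    refine ne_top_of_le_ne_top ?_ (measure_biUnion_finset_le _ _)
    exact (ENNReal.sum_lt_top.2 fun _ _ =>
      (measure_mono Set.inter_subset_left).trans_lt measure_ball_lt_top).ne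
  calc _ ≤ _ := measureReal_mono hsub hfin
    _ ≤ _ := measureReal_biUnion_finset_le _ _
    _ ≤ ∑ _p ∈ P, 2 * min δ ε := by
      apply Finset.sum_le_sum
      intro p _
      rw [mul_min_of_nonneg _ _ zero_le_two]
      apply le_min
      · rw [← Real.volume_real_ball hδ (a := (p.1 : ℝ) / m)]
        exact measureReal_mono Set.inter_subset_left measure_ball_lt_top.ne
      · rw [← Real.volume_real_ball hε (a := (p.2 : ℝ) / n)]
        exact measureReal_mono Set.inter_subset_right measure_ball_lt_top.ne
    _ = P.card * (2 * min δ ε) := by simp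
    _ ≤ (2 * (m * n * (δ + ε))) * (2 * min δ ε) := by
      gcongr
      exact card_coprime_pairs_le hmn hm hn (by positivity)
    _ = 4 * (m * n) * ((δ + ε) * min δ ε) := by ring
    _ ≤ 4 * (m * n) * (2 * (δ * ε)) := by
      refine mul_le_mul_of_nonneg_left ?_ (by positivity)
      rcases le_total δ ε with h | h
      · rw [min_eq_left h]; nlinarith
      · rw [min_eq_right h]; nlinarith
    _ = _ := by ring

/-- A finite Chung–Erdős inequality, in a form linear in the first moment. -/
lemma two_mul_sum_sub_le_measureReal_biUnion {Ω ι : Type*} [MeasurableSpace Ω] (μ : Measure Ω)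
    (A : ι → Set Ω) (hA : ∀ i, MeasurableSet (A i)) (hfin : ∀ i, μ (A i) ≠ ⊤) (W : Finset ι)
    (t : ℝ) :
    2 * t * ∑ i ∈ W, μ.real (A i) - t ^ 2 * ∑ i ∈ W, ∑ j ∈ W, μ.real (A i ∩ A j) ≤
      μ.real (⋃ i ∈ W, A i) := by
  classical
  have hInd : ∀ s, MeasurableSet s → μ s ≠ ⊤ → Integrable (s.indicator (1 : Ω → ℝ)) μ :=
    fun s hs hs' => (integrable_indicator_iff hs).2 (integrableOn_const hs')
  have hfin2 : ∀ i j, μ (A i ∩ A j) ≠ ⊤ := fun i j =>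
    ne_top_of_le_ne_top (hfin i) (measure_mono Set.inter_subset_left)
  have hU : MeasurableSet (⋃ i ∈ W, A i) := Finset.measurableSet_biUnion _ fun i _ => hA i
  have hUfin : μ (⋃ i ∈ W, A i) ≠ ⊤ :=
    ne_top_of_le_ne_top (ENNReal.sum_ne_top.2 fun i _ => hfin i) (measure_biUnion_finset_le _ _)
  have h1 : Integrable (fun x => ∑ i ∈ W, (A i).indicator (1 : Ω → ℝ) x) μ :=
    integrable_finsetSum _ fun i _ => hInd _ (hA i) (hfin i)
  have h2' : ∀ i, Integrable (fun x => ∑ j ∈ W, (A i ∩ A j).indicator (1 : Ω → ℝ) x) μ :=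
    fun i => integrable_finsetSum _ fun j _ => hInd _ ((hA i).inter (hA j)) (hfin2 i j)
  have h2 : Integrable (fun x => ∑ i ∈ W, ∑ j ∈ W, (A i ∩ A j).indicator (1 : Ω → ℝ) x) μ :=
    integrable_finsetSum _ fun i _ => h2' i
  have e1 : ∑ i ∈ W, μ.real (A i) = ∫ x, ∑ i ∈ W, (A i).indicator (1 : Ω → ℝ) x ∂μ := by
    rw [integral_finsetSum _ fun i _ => hInd _ (hA i) (hfin i)]
    exact Finset.sum_congr rfl fun i _ => (integral_indicator_one (hA i)).symm
  have e2 : ∑ i ∈ W, ∑ j ∈ W, μ.real (A i ∩ A j) =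
      ∫ x, ∑ i ∈ W, ∑ j ∈ W, (A i ∩ A j).indicator (1 : Ω → ℝ) x ∂μ := by
    rw [integral_finsetSum _ fun i _ => h2' i]
    refine Finset.sum_congr rfl fun i _ => ?_
    rw [integral_finsetSum _ fun j _ => hInd _ ((hA i).inter (hA j)) (hfin2 i j)]
    exact Finset.sum_congr rfl fun j _ => (integral_indicator_one ((hA i).inter (hA j))).symm
  rw [e1, e2, ← integral_indicator_one hU, ← integral_const_mul, ← integral_const_mul,
    ← integral_sub (h1.const_mul _) (h2.const_mul _)]
  refine integral_mono ((h1.const_mul _).sub (h2.const_mul _)) (hInd _ hU hUfin) fun x => ?_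
  simp only
  have hsq : ∑ i ∈ W, ∑ j ∈ W, (A i ∩ A j).indicator (1 : Ω → ℝ) x =
      (∑ i ∈ W, (A i).indicator (1 : Ω → ℝ) x) ^ 2 := by
    rw [sq, Finset.sum_mul_sum]
    simp [Set.inter_indicator_one]
  rw [hsq]
  by_cases hx : x ∈ ⋃ i ∈ W, A i
  · rw [Set.indicator_of_mem hx]
    simp only [Pi.one_apply]
    nlinarith [sq_nonneg (1 - t * ∑ i ∈ W, (A i).indicator (1 : Ω → ℝ) x)]
  · have : ∑ i ∈ W, (A i).indicator (1 : Ω → ℝ) x = 0 := by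
      refine Finset.sum_eq_zero fun i hi => Set.indicator_of_notMem (fun h => hx ?_) _
      simp only [Set.mem_iUnion]
      exact ⟨i, hi, h⟩
    rw [this, Set.indicator_of_notMem hx]
    simp

lemma exists_Ico_sum_ge {ψ : ℕ → ℝ} (h0 : ∀ n, 0 ≤ ψ n) (hs : ¬ Summable ψ) (M : ℕ) :
    ∃ M', 1 ≤ ∑ n ∈ Finset.Ico M M', ψ n := by
  have := (not_summable_iff_tendsto_nat_atTop_of_nonneg h0).1 hs
  obtain ⟨M', h1, h2⟩ := ((this.eventually_ge_atTop (1 + ∑ n ∈ Finset.range M, ψ n)).and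
    (eventually_ge_atTop M)).exists
  refine ⟨M', ?_⟩
  rw [Finset.sum_Ico_eq_sub _ h2]
  linarith

lemma volume_real_iUnion_reducedNbhd_ge {ψ : ℕ → ℝ} {κ : ℝ} (hκ : 0 < κ) (h0 : ∀ n, 0 ≤ ψ n)
    (h1 : ∀ n, ψ n ≤ 1 / 2) (hφ : ∀ n, ψ n ≠ 0 → κ * n ≤ n.totient) (hψ0 : ψ 0 = 0)
    (hs : ¬ Summable ψ) (M : ℕ) :
    2 * κ ^ 2 / 5 ≤ volume.real (⋃ n ∈ Set.Ici M, reducedNbhd n (ψ n / n)) := by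
  obtain ⟨M', hM'⟩ := exists_Ico_sum_ge h0 hs M
  set W := Finset.Ico M M'
  set Ψ := ∑ n ∈ W, ψ n
  have hmul : ∀ n : ℕ, n * (ψ n / n) = ψ n := by
    intro n
    rcases Nat.eq_zero_or_pos n with rfl | hn
    · simp [hψ0]
    · field_simp
  have hδ0 : ∀ n : ℕ, 0 ≤ ψ n / n := fun n => div_nonneg (h0 n) (by positivity)
  have hvol : ∀ n : ℕ, volume.real (reducedNbhd n (ψ n / n)) = n.totient * (2 * (ψ n / n)) :=
    fun n => volume_real_reducedNbhd (hδ0 n) (by rw [hmul]; exact h1 n)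
  have hlow : ∀ n : ℕ, 2 * κ * ψ n ≤ volume.real (reducedNbhd n (ψ n / n)) := by
    intro n
    rw [hvol]
    by_cases h : ψ n = 0
    · simp [h]
    · calc 2 * κ * ψ n = 2 * κ * (n * (ψ n / n)) := by rw [hmul]
        _ = κ * n * (2 * (ψ n / n)) := by ring
        _ ≤ _ := mul_le_mul_of_nonneg_right (hφ n h) (by linarith [hδ0 n])
  have hup : ∀ n : ℕ, volume.real (reducedNbhd n (ψ n / n)) ≤ 2 * ψ n := by
    intro n
    rw [hvol]
    calc _ ≤ (n : ℝ) * (2 * (ψ n / n)) := by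
          refine mul_le_mul_of_nonneg_right ?_ (by linarith [hδ0 n])
          exact_mod_cast Nat.totient_le n
      _ = 2 * (n * (ψ n / n)) := by ring
      _ = _ := by rw [hmul]
  have hpair : ∑ m ∈ W, ∑ n ∈ W,
      volume.real (reducedNbhd m (ψ m / m) ∩ reducedNbhd n (ψ n / n)) ≤ 10 * Ψ ^ 2 := by
    calc _ ≤ ∑ m ∈ W, ∑ n ∈ W, (8 * ψ m * ψ n + if m = n then 2 * ψ m else 0) := by
          refine Finset.sum_le_sum fun m _ => Finset.sum_le_sum fun n _ => ?_
          split_ifs with h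
          · subst h
            rw [Set.inter_self]
            have := mul_nonneg (h0 m) (h0 m)
            linarith [hup m]
          · rw [add_zero]
            have := volume_real_reducedNbhd_inter_le h (hδ0 m) (hδ0 n)
            rwa [hmul, hmul] at this
      _ = 8 * Ψ ^ 2 + 2 * Ψ := by
          simp only [Finset.sum_add_distrib, ← Finset.mul_sum, Finset.sum_ite_eq]
          rw [← Finset.sum_mul, ← Finset.mul_sum]
          have : ∑ x ∈ W, (if x ∈ W then 2 * ψ x else 0) = 2 * Ψ := by
            rw [Finset.mul_sum]
            exact Finset.sum_congr rfl fun x hx => by simp [hx]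
          rw [this]
          ring
      _ ≤ _ := by nlinarith
  have hks := two_mul_sum_sub_le_measureReal_biUnion volume (fun n => reducedNbhd n (ψ n / n))
    (fun n => measurableSet_reducedNbhd _ _) (fun n => volume_reducedNbhd_ne_top _ _) W
    (κ / (5 * Ψ))
  have hΨ : 0 < Ψ := by linarith
  calc 2 * κ ^ 2 / 5 = 2 * (κ / (5 * Ψ)) * (2 * κ * Ψ) - (κ / (5 * Ψ)) ^ 2 * (10 * Ψ ^ 2) := by
        field_simp; ring
    _ ≤ _ := by
        refine le_trans ?_ hks
        apply sub_le_sub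
        · refine mul_le_mul_of_nonneg_left ?_ (by positivity)
          rw [Finset.mul_sum]
          exact Finset.sum_le_sum fun n _ => hlow n
        · exact mul_le_mul_of_nonneg_left hpair (by positivity)
    _ ≤ _ := by
        refine measureReal_mono ?_ ?_
        · refine Set.biUnion_subset_biUnion_left fun n hn => ?_
          exact (Finset.mem_Ico.1 hn).1
        · refine ne_top_of_le_ne_top (measure_ball_lt_top (x := (0 : ℝ)) (r := 2)).ne
            (measure_mono (Set.iUnion₂_subset fun n _ => reducedNbhd_subset ?_))
          rcases Nat.eq_zero_or_pos n with rfl | hn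
          · simp
          · rw [div_le_one (by exact_mod_cast hn)]
            have : (1 : ℝ) ≤ n := by exact_mod_cast hn
            linarith [h1 n]

lemma ae_of_ae_unitAddCircle {P : UnitAddCircle → Prop} (h : ∀ᵐ y, P y) :
    ∀ᵐ x : ℝ, P (x : UnitAddCircle) := by
  have h1 : ∀ t : ℤ, ∀ᵐ x : ℝ ∂(volume.restrict (Set.Ioc (t : ℝ) (t + 1))),
      P (x : UnitAddCircle) := fun t =>
    (UnitAddCircle.measurePreserving_mk t).quasiMeasurePreserving.ae h
  have := (ae_restrict_iUnion_iff (fun t : ℤ => Set.Ioc (t : ℝ) (t + 1)) _).2 h1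
  rwa [iUnion_Ioc_intCast, Measure.restrict_univ] at this

lemma dn_le_abs_sub_intCast (x : ℝ) (m : ℤ) : dn x ≤ |x - m| := round_le x m

/-- The Duffin–Schaeffer theorem for approximating functions supported on integers `n` with
`φ(n) / n` bounded below. -/
theorem ae_frequently_dn_lt {ψ : ℕ → ℝ} {κ : ℝ} (hκ : 0 < κ) (h0 : ∀ n, 0 ≤ ψ n)
    (h1 : ∀ n, ψ n ≤ 1 / 2) (hφ : ∀ n, ψ n ≠ 0 → κ * n ≤ n.totient) (hψ0 : ψ 0 = 0)
    (hs : ¬ Summable ψ) : ∀ᵐ x : ℝ, ∃ᶠ n : ℕ in atTop, dn (n * x) < ψ n := by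
  have hδ : Tendsto (fun n : ℕ => ψ n / n) atTop (nhds 0) := by
    refine squeeze_zero (fun n => div_nonneg (h0 n) (by positivity)) (fun n => ?_)
      (tendsto_const_div_atTop_nhds_zero_nat (1 / 2 : ℝ))
    exact div_le_div_of_nonneg_right (h1 n) (by positivity)
  set U : ℕ → Set ℝ := fun M => ⋃ n ∈ Set.Ici M, reducedNbhd n (ψ n / n) with hU
  have hUm : ∀ M, MeasurableSet (U M) := fun M =>
    MeasurableSet.biUnion (Set.to_countable _) fun n _ => measurableSet_reducedNbhd _ _
  have hUfin : ∀ M, volume (U M) ≠ ⊤ := fun M => by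
    refine ne_top_of_le_ne_top (measure_ball_lt_top (x := (0 : ℝ)) (r := 2)).ne
      (measure_mono (Set.iUnion₂_subset fun n _ => reducedNbhd_subset ?_))
    rcases Nat.eq_zero_or_pos n with rfl | hn
    · simp
    · rw [div_le_one (by exact_mod_cast hn)]
      have : (1 : ℝ) ≤ n := by exact_mod_cast hn
      linarith [h1 n]
  have hanti : Antitone U := fun M M' h =>
    Set.biUnion_subset_biUnion_left (Set.Ici_subset_Ici.2 h)
  have hpos : volume (⋂ M, U M) ≠ 0 := by
    have ht := tendsto_measure_iInter_atTop (μ := volume)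
      (fun M => (hUm M).nullMeasurableSet) hanti ⟨0, hUfin 0⟩
    have hge : ENNReal.ofReal (2 * κ ^ 2 / 5) ≤ volume (⋂ M, U M) := by
      refine ge_of_tendsto' ht fun M => ?_
      rw [Function.comp_apply, ENNReal.ofReal_le_iff_le_toReal (hUfin M)]
      exact volume_real_iUnion_reducedNbhd_ge hκ h0 h1 hφ hψ0 hs M
    intro h
    rw [h] at hge
    have : 0 < ENNReal.ofReal (2 * κ ^ 2 / 5) := ENNReal.ofReal_pos.2 (by positivity)
    exact this.not_ge hge
  rcases AddCircle.addWellApproximable_ae_empty_or_univ (T := 1) (fun n => ψ n / n) hδ with h | h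
  · exfalso
    apply hpos
    refine measure_mono_null ?_ (ae_iff.1 (ae_of_ae_unitAddCircle h))
    intro x hx
    simp only [Set.mem_ofPred_eq, not_not]
    rw [UnitAddCircle.mem_addWellApproximable_iff, ← Nat.frequently_atTop_iff_infinite,
      frequently_atTop]
    intro M
    have hxM := Set.mem_iInter.1 hx M
    simp only [hU, reducedNbhd, Set.mem_iUnion, Finset.mem_filter, Finset.mem_range,
      exists_prop] at hxM
    obtain ⟨n, hn, a, ⟨ha, hco⟩, hxa⟩ := hxM
    refine ⟨n, hn, a, ha, (Nat.gcd_comm a n).trans hco, ?_⟩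
    rw [← AddCircle.coe_sub, UnitAddCircle.norm_eq]
    refine lt_of_le_of_lt (round_le _ 0) ?_
    simpa [Real.dist_eq] using hxa
  · filter_upwards [ae_of_ae_unitAddCircle h] with x hx
    rw [UnitAddCircle.mem_addWellApproximable_iff, ← Nat.frequently_atTop_iff_infinite] at hx
    refine (hx.and_eventually (eventually_gt_atTop 0)).mono ?_
    rintro n ⟨⟨a, -, -, hxa⟩, hn⟩
    have hnR : (0 : ℝ) < n := by exact_mod_cast hn
    rw [← AddCircle.coe_sub, UnitAddCircle.norm_eq] at hxa
    set m := round (x - (a : ℝ) / n)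
    calc dn (n * x) ≤ |n * x - ((a + n * m : ℤ) : ℝ)| := dn_le_abs_sub_intCast _ _
      _ = n * |x - a / n - m| := by
          rw [← abs_of_pos hnR, ← abs_mul, abs_of_pos hnR]
          congr 1
          push_cast
          field_simp
          ring
      _ < n * (ψ n / n) := by gcongr
      _ = ψ n := by field_simp

lemma dn_nonneg (x : ℝ) : 0 ≤ dn x := abs_nonneg _

lemma dn_le_half (x : ℝ) : dn x ≤ 1 / 2 := abs_sub_round x

lemma dn_neg (x : ℝ) : dn (-x) = dn x := by
  apply le_antisymm
  · refine (dn_le_abs_sub_intCast _ (-round x)).trans_eq ?_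
    rw [dn, ← abs_neg]
    push_cast
    ring_nf
  · refine (dn_le_abs_sub_intCast _ (-round (-x))).trans_eq ?_
    rw [dn, ← abs_neg]
    push_cast
    ring_nf

lemma dn_add_le (x y : ℝ) : dn (x + y) ≤ dn x + dn y := by
  refine (dn_le_abs_sub_intCast _ (round x + round y)).trans ?_
  refine le_trans (le_of_eq ?_) (abs_add_le _ _)
  push_cast
  ring_nf

lemma dn_natCast_mul_le (j : ℕ) (x : ℝ) : dn (j * x) ≤ j * dn x := by
  refine (dn_le_abs_sub_intCast _ (j * round x)).trans_eq ?_
  rw [dn]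
  push_cast
  rw [← mul_sub, abs_mul, Nat.abs_cast]

section Bohr

variable {ι : Type*} [Fintype ι]

open Classical in
/-- The integers `n` with `|n| ≤ X` and `‖n αᵢ‖ ≤ δᵢ` for all `i`. -/
noncomputable def bohr (α : ι → ℝ) (X : ℝ) (δ : ι → ℝ) : Finset ℤ :=
  (Finset.Icc (-⌊X⌋) ⌊X⌋).filter fun n => ∀ i, dn (n * α i) ≤ δ i

lemma mem_bohr {α : ι → ℝ} {X : ℝ} {δ : ι → ℝ} {n : ℤ} :
    n ∈ bohr α X δ ↔ |(n : ℝ)| ≤ X ∧ ∀ i, dn (n * α i) ≤ δ i := by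
  simp only [bohr, Finset.mem_filter, Finset.mem_Icc]
  rw [← abs_le, Int.le_floor, Int.cast_abs]

lemma bohr_mono (α : ι → ℝ) {X Y : ℝ} {δ ε : ι → ℝ} (h : X ≤ Y) (h' : ∀ i, δ i ≤ ε i) :
    bohr α X δ ⊆ bohr α Y ε := fun _ hn =>
  mem_bohr.2 ⟨(mem_bohr.1 hn).1.trans h, fun i => ((mem_bohr.1 hn).2 i).trans (h' i)⟩

lemma card_le_card_mul_of_coloring {κ : Type*} [DecidableEq κ] {A B : Finset ℤ} {t : Finset κ}
    (c : ℤ → κ) (g : ℤ → ℤ) (hc : ∀ a ∈ A, c a ∈ t) (hg : Set.InjOn g A)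
    (h : ∀ a ∈ A, ∀ a' ∈ A, c a = c a' → g a - g a' ∈ B) : A.card ≤ B.card * t.card := by
  refine Finset.card_le_mul_card_image_of_maps_to hc _ fun b _ => ?_
  rcases (A.filter fun a => c a = b).eq_empty_or_nonempty with h0 | ⟨a', ha'⟩
  · simp [h0]
  rw [Finset.mem_filter] at ha'
  refine Finset.card_le_card_of_injOn (fun a => g a - g a') ?_ ?_
  · intro a ha
    rw [Finset.mem_coe, Finset.mem_filter] at ha
    exact h a ha.1 a' ha'.1 (ha.2.trans ha'.2.symm)
  · intro a ha b hb hab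
    rw [Finset.mem_coe, Finset.mem_filter] at ha hb
    exact hg ha.1 hb.1 (by simpa using hab)

lemma floor_mem_Icc_of_abs_le {x : ℝ} {s : ℕ} (h : |x| ≤ s) :
    ⌊x⌋ ∈ Finset.Icc (-(s : ℤ)) s := by
  rw [Finset.mem_Icc]
  constructor
  · rw [Int.le_floor]
    push_cast
    exact (abs_le.1 h).1
  · have := (Int.floor_le x).trans (abs_le.1 h).2
    exact_mod_cast this

lemma abs_sub_lt_of_floor_div_eq {x y d : ℝ} (hd : 0 < d) (h : ⌊x / d⌋ = ⌊y / d⌋) :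
    |x - y| < d := by
  have := Int.abs_sub_lt_one_of_floor_eq_floor h
  rwa [← sub_div, abs_div, abs_of_pos hd, div_lt_one hd] at this

/-- A covering bound: multiples of `q` in a Bohr set, against a Bohr set smaller by `s * q`. -/
lemma card_le_card_bohr_mul (α : ι → ℝ) {X : ℝ} {δ : ι → ℝ} (hX : 0 < X) (hδ : ∀ i, 0 < δ i)
    {s q : ℕ} (hq : 0 < q) {A : Finset ℤ} (hA : A ⊆ bohr α (s * q * X) fun i => s * q * δ i)
    (hdvd : ∀ n ∈ A, (q : ℤ) ∣ n) :
    A.card ≤ (bohr α X δ).card * ((2 * s + 1) * ((2 * s + 1) * q) ^ Fintype.card ι) := by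
  classical
  have hqR : (0 : ℝ) < q := by exact_mod_cast hq
  set t : Finset (ℤ × (ι → ℤ × ℤ)) := Finset.Icc (-(s : ℤ)) s ×ˢ
    Fintype.piFinset fun _ : ι => Finset.Icc (-(s : ℤ)) s ×ˢ Finset.Ico (0 : ℤ) q
  have ht : t.card = (2 * s + 1) * ((2 * s + 1) * q) ^ Fintype.card ι := by
    simp only [t, Finset.card_product, Fintype.card_piFinset, Int.card_Icc, Int.card_Ico,
      Finset.prod_const, Finset.card_univ]
    rw [show ((s : ℤ) + 1 - -s).toNat = 2 * s + 1 by omega]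
    simp
  rw [← ht]
  refine card_le_card_mul_of_coloring (fun n : ℤ => (⌊(n : ℝ) / (q * X)⌋, fun i =>
    (⌊((n : ℝ) * α i - round ((n : ℝ) * α i)) / (q * δ i)⌋, round ((n : ℝ) * α i) % q)))
    (fun n => n / q) ?_ ?_ ?_
  · intro n hn
    obtain ⟨h1, h2⟩ := mem_bohr.1 (hA hn)
    simp only [t, Finset.mem_product, Fintype.mem_piFinset]
    refine ⟨floor_mem_Icc_of_abs_le ?_, fun i => ⟨floor_mem_Icc_of_abs_le ?_, ?_⟩⟩
    · rw [abs_div, abs_of_pos (mul_pos hqR hX), div_le_iff₀ (mul_pos hqR hX)]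
      linarith
    · rw [abs_div, abs_of_pos (mul_pos hqR (hδ i)), div_le_iff₀ (mul_pos hqR (hδ i))]
      have := h2 i
      rw [dn] at this
      linarith
    · rw [Finset.mem_Ico]
      have : (0 : ℤ) < q := by exact_mod_cast hq
      exact ⟨Int.emod_nonneg _ this.ne', Int.emod_lt_of_pos _ this⟩
  · intro n hn n' hn' h
    simp only at h
    rw [← Int.ediv_mul_cancel (hdvd n hn), h, Int.ediv_mul_cancel (hdvd n' hn')]
  · intro n hn n' hn' h
    obtain ⟨m, rfl⟩ := hdvd n hn
    obtain ⟨m', rfl⟩ := hdvd n' hn'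
    have hq' : (q : ℤ) ≠ 0 := by exact_mod_cast hq.ne'
    simp only [Prod.mk.injEq] at h
    obtain ⟨h1, h2⟩ := h
    simp only [Int.mul_ediv_cancel_left _ hq']
    refine mem_bohr.2 ⟨?_, fun i => ?_⟩
    · have := abs_sub_lt_of_floor_div_eq (mul_pos hqR hX) h1
      push_cast at this ⊢
      rw [← mul_sub, abs_mul, abs_of_pos hqR] at this
      exact (lt_of_mul_lt_mul_left this hqR.le).le
    · have h2i := congrFun h2 i
      simp only [Prod.mk.injEq] at h2i
      have h3 := abs_sub_lt_of_floor_div_eq (mul_pos hqR (hδ i)) h2i.1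
      obtain ⟨h, hh⟩ : (q : ℤ) ∣ round (((q * m : ℤ) : ℝ) * α i) -
        round (((q * m' : ℤ) : ℝ) * α i) := Int.ModEq.dvd (Eq.symm h2i.2)
      have hh' : ((round (((q * m : ℤ) : ℝ) * α i) : ℝ)) -
        round (((q * m' : ℤ) : ℝ) * α i) = q * h := by exact_mod_cast hh
      refine (dn_le_abs_sub_intCast _ h).trans ?_
      refine (lt_of_mul_lt_mul_left ?_ hqR.le).le
      refine lt_of_eq_of_lt ?_ h3
      rw [← abs_of_pos hqR, ← abs_mul]
      congr 1
      rw [mul_sub, ← hh']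
      push_cast
      ring

lemma le_card_bohr_mul (α : ι → ℝ) (N : ℕ) (j : ι → ℕ) :
    N ≤ (bohr α N fun i => ((2 : ℝ) ^ j i)⁻¹).card * 2 ^ ∑ i, j i := by
  classical
  set t : Finset (ι → ℤ) := Fintype.piFinset fun i => Finset.Ico (0 : ℤ) (2 ^ j i)
  have ht : t.card = 2 ^ ∑ i, j i := by
    simp only [t, Fintype.card_piFinset, Int.card_Ico, ← Finset.prod_pow_eq_pow_sum]
    refine Finset.prod_congr rfl fun i _ => ?_
    rw [sub_zero]
    exact_mod_cast Int.toNat_natCast (2 ^ j i)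
  have hA : N ≤ (Finset.Icc (0 : ℤ) N).card := by
    rw [Int.card_Icc]
    omega
  rw [← ht]
  refine hA.trans (card_le_card_mul_of_coloring
    (fun n i => ⌊Int.fract ((n : ℝ) * α i) / ((2 : ℝ) ^ j i)⁻¹⌋) id ?_ (Set.injOn_id _) ?_)
  · intro n _
    refine Fintype.mem_piFinset.2 fun i => Finset.mem_Ico.2 ⟨?_, ?_⟩
    · exact Int.floor_nonneg.2 (div_nonneg (Int.fract_nonneg _) (by positivity))
    · rw [Int.floor_lt, div_inv_eq_mul]
      push_cast
      have := Int.fract_lt_one ((n : ℝ) * α i)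
      have h2 : (0 : ℝ) < 2 ^ j i := by positivity
      nlinarith
  · intro n hn n' hn' h
    rw [Finset.mem_Icc] at hn hn'
    refine mem_bohr.2 ⟨?_, fun i => ?_⟩
    · have : |n - n'| ≤ (N : ℤ) := by rw [abs_le]; constructor <;> omega
      simp only [id]
      exact_mod_cast this
    · have := abs_sub_lt_of_floor_div_eq (by positivity) (congrFun h i)
      refine le_trans ?_ this.le
      refine (dn_le_abs_sub_intCast _ (⌊(n : ℝ) * α i⌋ - ⌊(n' : ℝ) * α i⌋)).trans_eq ?_
      simp only [Int.fract, id]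
      push_cast
      ring_nf

lemma mul_card_filter_dvd_bohr_le (α : ι → ℝ) {X : ℝ} {δ : ι → ℝ} {p : ℕ} (hp : p.Prime) {b : ℤ}
    (hb : b ∈ bohr α (X / p) fun i => δ i / p) (hpb : ¬ (p : ℤ) ∣ b) :
    p * ((bohr α X δ).filter fun n => (p : ℤ) ∣ n).card ≤
      (bohr α (2 * X) fun i => 2 * δ i).card := by
  have hpR : (0 : ℝ) < p := by exact_mod_cast hp.pos
  obtain ⟨hb1, hb2⟩ := mem_bohr.1 hb
  calc _ = (((bohr α X δ).filter fun n => (p : ℤ) ∣ n) ×ˢ Finset.range p).card := by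
        rw [Finset.card_product, Finset.card_range, mul_comm]
    _ ≤ _ := ?_
  refine Finset.card_le_card_of_injOn (fun x => x.1 + x.2 * b) ?_ ?_
  · rintro ⟨a, j⟩ h
    simp only [Finset.coe_product, Finset.coe_filter, Finset.coe_range, Set.mem_prod,
      Set.mem_ofPred_eq, Set.mem_Iio] at h
    obtain ⟨⟨ha, -⟩, hj⟩ := h
    obtain ⟨ha1, ha2⟩ := mem_bohr.1 ha
    have hjp : (j : ℝ) ≤ p := by exact_mod_cast hj.le
    refine mem_bohr.2 ⟨?_, fun i => ?_⟩
    · push_cast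
      refine (abs_add_le _ _).trans ?_
      rw [abs_mul, Nat.abs_cast]
      have : (j : ℝ) * |(b : ℝ)| ≤ p * (X / p) := by gcongr
      rw [mul_div_cancel₀ _ hpR.ne'] at this
      linarith
    · push_cast
      rw [add_mul]
      refine (dn_add_le _ _).trans ?_
      have h1 := dn_natCast_mul_le j ((b : ℝ) * α i)
      rw [← mul_assoc] at h1
      have h2 : (j : ℝ) * dn (b * α i) ≤ p * (δ i / p) := by
        gcongr
        · exact dn_nonneg _
        · exact hb2 i
      rw [mul_div_cancel₀ _ hpR.ne'] at h2
      linarith [ha2 i]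
  · rintro ⟨a, j⟩ h ⟨a', j'⟩ h' he
    simp only [Finset.coe_product, Finset.coe_filter, Finset.coe_range, Set.mem_prod,
      Set.mem_ofPred_eq, Set.mem_Iio] at h h' he
    have hdvd : (p : ℤ) ∣ ((j : ℤ) - j') * b := by
      have : ((j : ℤ) - j') * b = a' - a := by linarith
      rw [this]
      exact dvd_sub h'.1.2 h.1.2
    have hjj := ((Nat.prime_iff_prime_int.1 hp).dvd_or_dvd hdvd).resolve_right hpb
    have : (j : ℤ) - j' = 0 := Int.eq_zero_of_abs_lt_dvd hjj (by rw [abs_lt]; constructor <;> omega)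
    have hj : j = j' := by omega
    subst hj
    simp only [Prod.mk.injEq, and_true]
    linarith

lemma le_of_le_pow_mul {R N M D p K T : ℕ} (hN : 0 < N) (hK : K ^ 2 ≤ p ^ (2 * R + 1))
    (hNK : N ≤ K ^ (T + 1) * D) (hT : D * p ^ ((R + 1) * T) ≤ N * M) (hpM : p ≤ M) :
    N ≤ M ^ ((R + 2) * (2 * R + 1)) * D := by
  have h1 : N ^ 2 ≤ p ^ ((2 * R + 1) * (T + 1)) * D ^ 2 := by
    calc N ^ 2 ≤ (K ^ (T + 1) * D) ^ 2 := by gcongr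
      _ = (K ^ 2) ^ (T + 1) * D ^ 2 := by ring
      _ ≤ (p ^ (2 * R + 1)) ^ (T + 1) * D ^ 2 := by gcongr
      _ = _ := by rw [← pow_mul]
  have h2 : p ^ ((R + 1) * (T + 1)) * D ≤ M ^ (R + 2) * N := by
    calc p ^ ((R + 1) * (T + 1)) * D = p ^ (R + 1) * (D * p ^ ((R + 1) * T)) := by ring
      _ ≤ M ^ (R + 1) * (N * M) := by gcongr
      _ = _ := by ring
  have h3 : N ^ (2 * R + 1) * N ≤ N ^ (2 * R + 1) * (M ^ ((R + 2) * (2 * R + 1)) * D) := by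
    calc N ^ (2 * R + 1) * N = (N ^ 2) ^ (R + 1) := by ring
      _ ≤ (p ^ ((2 * R + 1) * (T + 1)) * D ^ 2) ^ (R + 1) := by gcongr
      _ = (p ^ ((R + 1) * (T + 1)) * D) ^ (2 * R + 1) * D := by ring
      _ ≤ (M ^ (R + 2) * N) ^ (2 * R + 1) * D := by gcongr
      _ = _ := by ring
  exact Nat.le_of_mul_le_mul_left h3 (by positivity)

lemma dn_natAbs_mul (n : ℤ) (x : ℝ) : dn ((n.natAbs : ℝ) * x) = dn (n * x) := by
  rw [Nat.cast_natAbs, Int.cast_abs]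
  rcases abs_choice (n : ℝ) with h | h
  · rw [h]
  · rw [h, neg_mul, dn_neg]

lemma card_bohr_le_one (α : ι → ℝ) {X : ℝ} {δ : ι → ℝ} {N M : ℕ} (hXN : X ≤ N)
    (hbad : ∀ n : ℕ, 1 ≤ n → n ≤ N → 1 ≤ (n : ℝ) * M * ∏ i, dn (n * α i))
    (hX : 0 ≤ X) (h : X * M * ∏ i, δ i < 1) : (bohr α X δ).card ≤ 1 := by
  rw [Finset.card_le_one_iff_subset_singleton]
  refine ⟨0, fun n hn => ?_⟩
  rw [Finset.mem_singleton]
  by_contra hn0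
  obtain ⟨h1, h2⟩ := mem_bohr.1 hn
  have h3 : (n.natAbs : ℝ) ≤ X := by rwa [Nat.cast_natAbs, Int.cast_abs]
  have h4 := hbad n.natAbs (Int.natAbs_pos.2 hn0) (by exact_mod_cast h3.trans hXN)
  simp only [dn_natAbs_mul] at h4
  have h5 : (n.natAbs : ℝ) * M * ∏ i, dn (n * α i) ≤ X * M * ∏ i, δ i := by
    gcongr with i
    · exact Finset.prod_nonneg fun i _ => dn_nonneg _
    · exact fun i _ => dn_nonneg _
    · exact h2 i
  linarith

lemma prod_inv_two_pow (j : ι → ℕ) : ∏ i, ((2 : ℝ) ^ j i)⁻¹ = ((2 ^ ∑ i, j i : ℕ) : ℝ)⁻¹ := by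
  rw [Finset.prod_inv_distrib, Finset.prod_pow_eq_pow_sum]
  push_cast
  rfl

lemma exists_mem_bohr_not_dvd (α : ι → ℝ) {N M p : ℕ} (j : ι → ℕ) (hN : 0 < N)
    (hp : 9 ^ (Fintype.card ι + 1) ≤ p) (hpM : p ≤ M)
    (hbad : ∀ n : ℕ, 1 ≤ n → n ≤ N → 1 ≤ (n : ℝ) * M * ∏ i, dn (n * α i))
    (hlarge : M ^ ((Fintype.card ι + 2) * (2 * Fintype.card ι + 1)) * 2 ^ ∑ i, j i < N) :
    ∃ b ∈ bohr α N fun i => ((2 : ℝ) ^ j i)⁻¹, ¬ (p : ℤ) ∣ b := by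
  by_contra! hall
  set R := Fintype.card ι with hR
  set D := 2 ^ ∑ i, j i with hD
  have hp1 : 1 < p := lt_of_lt_of_le (Nat.one_lt_pow (by omega) (by norm_num)) hp
  have hp0 : 0 < p := by omega
  have hpR : (0 : ℝ) < p := by exact_mod_cast hp0
  have hpR1 : (1 : ℝ) ≤ p := by exact_mod_cast hp0
  have hNR : (0 : ℝ) < N := by exact_mod_cast hN
  have hD0 : 0 < D := by positivity
  have hM0 : 0 < M := by omega
  set f : ℕ → ℕ := fun t =>
    (bohr α (N / (p : ℝ) ^ t) fun i => ((2 : ℝ) ^ j i)⁻¹ / (p : ℝ) ^ t).card with hf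
  set K := 3 * (3 * p) ^ R with hK
  have hstep : ∀ t, f t ≤ f (t + 1) * K := by
    intro t
    have := card_le_card_bohr_mul α (X := N / (p : ℝ) ^ (t + 1))
      (δ := fun i => ((2 : ℝ) ^ j i)⁻¹ / (p : ℝ) ^ (t + 1)) (by positivity)
      (fun i => by positivity) (s := 1) (q := p) hp0
      (A := bohr α (N / (p : ℝ) ^ t) fun i => ((2 : ℝ) ^ j i)⁻¹ / (p : ℝ) ^ t) ?_ ?_
    · simpa [hf, hK, hR] using this
    · refine bohr_mono α (le_of_eq ?_) fun i => le_of_eq ?_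
      · rw [Nat.cast_one, one_mul, pow_succ]
        field_simp
      · rw [Nat.cast_one, one_mul, pow_succ]
        field_simp
    · intro n hn
      refine hall n (bohr_mono α ?_ (fun i => ?_) hn)
      · exact div_le_self hNR.le (one_le_pow₀ hpR1)
      · exact div_le_self (by positivity) (one_le_pow₀ hpR1)
  have hiter : ∀ t, f 0 ≤ K ^ t * f t := by
    intro t
    induction t with
    | zero => simp
    | succ t ih =>
      calc f 0 ≤ K ^ t * f t := ih
        _ ≤ K ^ t * (f (t + 1) * K) := by gcongr; exact hstep t
        _ = _ := by ring
  have h0 : N ≤ f 0 * D := by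
    have := le_card_bohr_mul α N j
    simpa [hf] using this
  have hex : ∃ t, N * M < D * p ^ ((R + 1) * t) := by
    refine ⟨N * M, ?_⟩
    calc N * M < p ^ (N * M) := Nat.lt_pow_self hp1
      _ ≤ p ^ ((R + 1) * (N * M)) := Nat.pow_le_pow_right hp0 (Nat.le_mul_of_pos_left _ (by omega))
      _ ≤ _ := Nat.le_mul_of_pos_left _ hD0
  obtain ⟨T, hT⟩ : ∃ T, Nat.find hex = T + 1 := by
    refine Nat.exists_eq_succ_of_ne_zero fun h => ?_
    have := Nat.find_spec hex
    rw [h] at this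
    simp only [mul_zero, pow_zero, mul_one] at this
    have h1 : D ≤ M ^ ((R + 2) * (2 * R + 1)) * D := Nat.le_mul_of_pos_left _ (by positivity)
    have h2 : N ≤ N * M := Nat.le_mul_of_pos_right _ hM0
    omega
  have hT1 : N * M < D * p ^ ((R + 1) * (T + 1)) := hT ▸ Nat.find_spec hex
  have hT0 : D * p ^ ((R + 1) * T) ≤ N * M := not_lt.1 (Nat.find_min hex (by omega))
  have hfT : f (T + 1) ≤ 1 := by
    refine card_bohr_le_one α (div_le_self hNR.le (one_le_pow₀ hpR1)) hbad (by positivity) ?_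
    rw [Finset.prod_div_distrib, prod_inv_two_pow, Finset.prod_const, Finset.card_univ, ← hR,
      ← hD]
    have hDR : (0 : ℝ) < D := by exact_mod_cast hD0
    have hT1' : (N : ℝ) * M < D * p ^ ((R + 1) * (T + 1)) := by exact_mod_cast hT1
    calc _ = ((N : ℝ) * M) / (D * p ^ ((R + 1) * (T + 1))) := by
          field_simp
          ring
      _ < 1 := (div_lt_one (by positivity)).2 hT1'
  have hKp : K ^ 2 ≤ p ^ (2 * R + 1) := by
    calc K ^ 2 = 9 ^ (R + 1) * p ^ (2 * R) := by
          have : 9 ^ (R + 1) = (3 ^ (R + 1)) ^ 2 := by rw [← pow_mul, mul_comm, pow_mul]; norm_num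
          rw [hK, this]
          ring
      _ ≤ p * p ^ (2 * R) := by gcongr
      _ = _ := by ring
  have hNK : N ≤ K ^ (T + 1) * D := by
    calc N ≤ f 0 * D := h0
      _ ≤ K ^ (T + 1) * f (T + 1) * D := by gcongr; exact hiter _
      _ ≤ K ^ (T + 1) * 1 * D := by gcongr
      _ = _ := by ring
  exact absurd (le_of_le_pow_mul hN hKp hNK hT0 hpM) (not_le.2 hlarge)

/-- An exponent `E`, depending only on the dimension, such that Bohr sets of length `M ^ E` and
widths at least `1 / M` are well distributed modulo primes up to `M`. -/
def bohrExponent (R : ℕ) : ℕ := (R + 2) * (2 * R + 1) + 2 * R + 2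

lemma mul_card_filter_dvd_le (α : ι → ℝ) {l p : ℕ} (hl : 1 ≤ l) (j : ι → ℕ) (hj : ∀ i, j i ≤ l)
    (hprime : p.Prime) (hp : 9 ^ (Fintype.card ι + 1) ≤ p) (hpM : p ≤ 2 ^ l)
    (hbad : ∀ n : ℕ, 1 ≤ n → n ≤ (2 ^ l) ^ bohrExponent (Fintype.card ι) →
      1 ≤ (n : ℝ) * (2 ^ l : ℕ) * ∏ i, dn (n * α i)) :
    p * ((bohr α ((2 ^ l) ^ bohrExponent (Fintype.card ι) : ℕ) fun i =>
        ((2 : ℝ) ^ j i)⁻¹).filter fun n => (p : ℤ) ∣ n).card ≤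
      5 ^ (Fintype.card ι + 1) *
        (bohr α ((2 ^ l) ^ bohrExponent (Fintype.card ι) : ℕ) fun i => ((2 : ℝ) ^ j i)⁻¹).card := by
  set R := Fintype.card ι with hR
  set M := 2 ^ l with hM
  have hM1 : 1 < M := Nat.one_lt_pow (by omega) (by norm_num)
  have hM0 : 0 < M := by omega
  set E' := (R + 2) * (2 * R + 1) + 2 * R + 1 with hE'
  have hE : bohrExponent R = E' + 1 := rfl
  have hpR : (0 : ℝ) < p := by exact_mod_cast hprime.pos
  have hpMR : (p : ℝ) ≤ M := by exact_mod_cast hpM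
  have hMR : (0 : ℝ) < M := by exact_mod_cast hM0
  have hlarge : M ^ ((R + 2) * (2 * R + 1)) * 2 ^ ∑ i, (j i + l) < M ^ E' := by
    calc M ^ ((R + 2) * (2 * R + 1)) * 2 ^ ∑ i, (j i + l) ≤
          M ^ ((R + 2) * (2 * R + 1)) * M ^ (2 * R) := by
          refine Nat.mul_le_mul_left _ ?_
          rw [hM, ← pow_mul]
          refine Nat.pow_le_pow_right (by norm_num) ?_
          calc ∑ i, (j i + l) ≤ ∑ _i : ι, (l + l) := by gcongr with i; exact hj i
            _ = l * (2 * R) := by simp [← hR]; ring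
      _ = M ^ ((R + 2) * (2 * R + 1) + 2 * R) := by rw [← pow_add]
      _ < M ^ E' := Nat.pow_lt_pow_right hM1 (by omega)
  obtain ⟨b, hb, hpb⟩ := exists_mem_bohr_not_dvd α (N := M ^ E') (M := M) (p := p)
    (fun i => j i + l) (by positivity) hp hpM (fun n h1 h2 => hbad n h1
      (h2.trans (Nat.pow_le_pow_right hM0 (Nat.le_succ _)))) hlarge
  have hb' : b ∈ bohr α (((M ^ bohrExponent R : ℕ) : ℝ) / p) fun i => ((2 : ℝ) ^ j i)⁻¹ / p := by
    refine bohr_mono α ?_ (fun i => ?_) hb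
    · rw [le_div_iff₀ hpR, hE, pow_succ M E']
      push_cast
      exact mul_le_mul_of_nonneg_left hpMR (by positivity)
    · rw [pow_add, mul_inv, div_eq_mul_inv]
      refine mul_le_mul_of_nonneg_left (inv_anti₀ hpR ?_) (by positivity)
      rw [hM] at hpMR
      exact_mod_cast hpMR
  refine (mul_card_filter_dvd_bohr_le α hprime hb' hpb).trans ?_
  have := card_le_card_bohr_mul α (X := ((M ^ bohrExponent R : ℕ) : ℝ))
    (δ := fun i => ((2 : ℝ) ^ j i)⁻¹) (by positivity) (fun i => by positivity) (s := 2) (q := 1)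
    one_pos (A := bohr α (2 * ((M ^ bohrExponent R : ℕ) : ℝ)) fun i => 2 * ((2 : ℝ) ^ j i)⁻¹)
    (by simp) (by simp)
  refine this.trans_eq ?_
  rw [← hR]
  ring

/-- The sum of `1 / p` over the primes `p` dividing `n`. -/
noncomputable def primeRecipSum (n : ℕ) : ℝ := ∑ p ∈ n.primeFactors, (p : ℝ)⁻¹

lemma exp_neg_mul_le_totient {n : ℕ} {C : ℝ} (h : primeRecipSum n ≤ C) :
    Real.exp (-2 * C) * n ≤ n.totient := by
  have h1 : (n.totient : ℝ) = n * ∏ p ∈ n.primeFactors, (1 - (p : ℝ)⁻¹) := by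
    have := congrArg (fun x : ℚ => (x : ℝ)) (Nat.totient_eq_mul_prod_factors n)
    push_cast at this
    exact this
  rw [h1, mul_comm]
  refine mul_le_mul_of_nonneg_left ?_ (by positivity)
  calc Real.exp (-2 * C) ≤ Real.exp (∑ p ∈ n.primeFactors, -2 * (p : ℝ)⁻¹) := by
        rw [← Finset.mul_sum]
        apply Real.exp_le_exp.2
        rw [primeRecipSum] at h
        linarith
    _ = ∏ p ∈ n.primeFactors, Real.exp (-2 * (p : ℝ)⁻¹) := Real.exp_sum _ _
    _ ≤ _ := by
        refine Finset.prod_le_prod (fun _ _ => (Real.exp_pos _).le) fun p hp => ?_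
        have hp2 : (2 : ℝ) ≤ p := by exact_mod_cast (Nat.prime_of_mem_primeFactors hp).two_le
        have hx : (p : ℝ)⁻¹ ≤ 1 / 2 := by
          rw [one_div]
          exact inv_anti₀ two_pos hp2
        have hx0 : 0 < (p : ℝ)⁻¹ := by positivity
        set x := (p : ℝ)⁻¹
        rw [neg_mul, Real.exp_neg]
        have h2 : 1 + 2 * x ≤ Real.exp (2 * x) := by linarith [Real.add_one_le_exp (2 * x)]
        calc (Real.exp (2 * x))⁻¹ ≤ (1 + 2 * x)⁻¹ := inv_anti₀ (by positivity) h2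
          _ ≤ 1 - x := by
            rw [inv_le_iff_one_le_mul₀ (by positivity)]
            nlinarith

lemma card_primeFactors_gt_le {n M E : ℕ} (hM : 1 < M) (hn : 0 < n) (h : n ≤ M ^ E) :
    (n.primeFactors.filter fun p => M < p).card ≤ E := by
  set s := n.primeFactors.filter fun p => M < p
  have h1 : M ^ s.card ≤ ∏ p ∈ s, p := Finset.pow_card_le_prod s (fun p => p) M fun p hp =>
    (Finset.mem_filter.1 hp).2.le
  have h2 : ∏ p ∈ s, p ≤ ∏ p ∈ n.primeFactors, p :=
    Finset.prod_le_prod_of_subset_of_one_le' (Finset.filter_subset _ _) fun p hp _ =>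
      (Nat.prime_of_mem_primeFactors hp).one_le
  have h3 : ∏ p ∈ n.primeFactors, p ≤ n := Nat.le_of_dvd hn (Nat.prod_primeFactors_dvd n)
  exact (Nat.pow_le_pow_iff_right hM).1 (h1.trans (h2.trans (h3.trans h)))

lemma primeRecipSum_le {n M E C : ℕ} (hM : 1 < M) (hn : 0 < n) (h : n ≤ M ^ E) :
    primeRecipSum n ≤
      C + (∑ p ∈ (Finset.Ioo (C - 1) (M + 1)).filter fun p => p.Prime ∧ p ∣ n, (p : ℝ)⁻¹) + E := by
  have hle1 : ∀ p ∈ n.primeFactors, (p : ℝ)⁻¹ ≤ 1 := fun p hp =>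
    inv_le_one_of_one_le₀ (by exact_mod_cast (Nat.prime_of_mem_primeFactors hp).one_le)
  have hsub : n.primeFactors ⊆ (n.primeFactors.filter fun p => p < C) ∪
      ((Finset.Ioo (C - 1) (M + 1)).filter fun p => p.Prime ∧ p ∣ n) ∪
      (n.primeFactors.filter fun p => M < p) := by
    intro p hp
    have hdvd := Nat.dvd_of_mem_primeFactors hp
    simp only [Finset.mem_union, Finset.mem_filter, Finset.mem_Ioo]
    by_cases h1 : p < C
    · exact Or.inl (Or.inl ⟨hp, h1⟩)
    by_cases h2 : M < p
    · exact Or.inr ⟨hp, h2⟩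
    · have := (Nat.prime_of_mem_primeFactors hp).pos
      exact Or.inl (Or.inr ⟨by omega, Nat.prime_of_mem_primeFactors hp, hdvd⟩)
  have hnn : ∀ p : ℕ, (0 : ℝ) ≤ (p : ℝ)⁻¹ := fun p => by positivity
  have hunion : ∀ s t : Finset ℕ, ∑ p ∈ s ∪ t, (p : ℝ)⁻¹ ≤
      ∑ p ∈ s, (p : ℝ)⁻¹ + ∑ p ∈ t, (p : ℝ)⁻¹ := fun s t => by
    rw [← Finset.sum_union_inter]
    have := Finset.sum_nonneg fun p (_ : p ∈ s ∩ t) => hnn p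
    linarith
  have hA : ∑ p ∈ n.primeFactors.filter (fun p => p < C), (p : ℝ)⁻¹ ≤ C := by
    calc _ ≤ ∑ p ∈ n.primeFactors.filter (fun p => p < C), (1 : ℝ) :=
          Finset.sum_le_sum fun p hp => hle1 p (Finset.mem_filter.1 hp).1
      _ = ((n.primeFactors.filter (fun p => p < C)).card : ℝ) := by simp
      _ ≤ ((Finset.range C).card : ℝ) := by
          refine Nat.cast_le.2 (Finset.card_le_card fun p hp => ?_)
          exact Finset.mem_range.2 (Finset.mem_filter.1 hp).2
      _ = C := by simp
  have hB : ∑ p ∈ n.primeFactors.filter (fun p => M < p), (p : ℝ)⁻¹ ≤ E := by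
    calc _ ≤ ∑ p ∈ n.primeFactors.filter (fun p => M < p), (1 : ℝ) :=
          Finset.sum_le_sum fun p hp => hle1 p (Finset.mem_filter.1 hp).1
      _ = ((n.primeFactors.filter (fun p => M < p)).card : ℝ) := by simp
      _ ≤ E := by exact_mod_cast card_primeFactors_gt_le hM hn h
  have h1 := Finset.sum_le_sum_of_subset_of_nonneg hsub fun p _ _ => hnn p
  have h2 := hunion ((n.primeFactors.filter fun p => p < C) ∪
      ((Finset.Ioo (C - 1) (M + 1)).filter fun p => p.Prime ∧ p ∣ n))
      (n.primeFactors.filter fun p => M < p)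
  have h3 := hunion (n.primeFactors.filter fun p => p < C)
      ((Finset.Ioo (C - 1) (M + 1)).filter fun p => p.Prime ∧ p ∣ n)
  rw [primeRecipSum]
  linarith

open Classical in
/-- The positive part of a Bohr set, as natural numbers. -/
noncomputable def bohrPos (α : ι → ℝ) (N : ℕ) (δ : ι → ℝ) : Finset ℕ :=
  (Finset.Icc 1 N).filter fun n => ∀ i, dn (n * α i) ≤ δ i

lemma mem_bohrPos {α : ι → ℝ} {N : ℕ} {δ : ι → ℝ} {n : ℕ} :
    n ∈ bohrPos α N δ ↔ (1 ≤ n ∧ n ≤ N) ∧ ∀ i, dn (n * α i) ≤ δ i := by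
  simp [bohrPos]

lemma card_bohr_le_two_mul (α : ι → ℝ) (N : ℕ) (δ : ι → ℝ) :
    (bohr α N δ).card ≤ 2 * ((bohrPos α N δ).card + 1) := by
  classical
  calc _ ≤ 2 * (insert 0 (bohrPos α N δ)).card := by
        refine Finset.card_le_mul_card_image_of_maps_to (f := Int.natAbs) ?_ 2 fun b _ => ?_
        · intro n hn
          obtain ⟨h1, h2⟩ := mem_bohr.1 hn
          rcases Nat.eq_zero_or_pos n.natAbs with h | h
          · rw [h]
            exact Finset.mem_insert_self _ _
          · refine Finset.mem_insert_of_mem (mem_bohrPos.2 ⟨⟨h, ?_⟩, fun i => ?_⟩)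
            · rw [← Int.cast_abs, ← Nat.cast_natAbs] at h1
              exact_mod_cast h1
            · rw [dn_natAbs_mul]
              exact h2 i
        · refine (Finset.card_le_card (t := {(b : ℤ), -(b : ℤ)}) fun n hn => ?_).trans
            Finset.card_le_two
          have := (Finset.mem_filter.1 hn).2
          rw [Finset.mem_insert, Finset.mem_singleton]
          omega
    _ ≤ _ := by
        gcongr
        exact Finset.card_insert_le _ _

lemma card_filter_dvd_bohrPos_le (α : ι → ℝ) (N : ℕ) (δ : ι → ℝ) (p : ℕ) :
    ((bohrPos α N δ).filter fun n => p ∣ n).card ≤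
      ((bohr α N δ).filter fun n => (p : ℤ) ∣ n).card := by
  refine Finset.card_le_card_of_injOn (fun n : ℕ => (n : ℤ)) (fun n hn => ?_)
    Nat.cast_injective.injOn
  simp only [Finset.coe_filter, Set.mem_ofPred_eq, mem_bohrPos] at hn
  simp only [Finset.coe_filter, Set.mem_ofPred_eq, mem_bohr]
  refine ⟨⟨?_, fun i => ?_⟩, by exact_mod_cast hn.2⟩
  · push_cast
    rw [Nat.abs_cast]
    exact_mod_cast hn.1.1.2
  · have := hn.1.2 i
    push_cast
    exact this

/-- A bound for `primeRecipSum` which holds on a positive proportion of suitable Bohr sets. -/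
def recipBound (R : ℕ) : ℕ := 90 ^ (R + 1) + 1 + bohrExponent R

open Classical in
lemma card_bohr_le_eight_mul (α : ι → ℝ) {l : ℕ} (hl : 1 ≤ l) (j : ι → ℕ) (hj : ∀ i, j i ≤ l)
    (hbad : ∀ n : ℕ, 1 ≤ n → n ≤ (2 ^ l) ^ bohrExponent (Fintype.card ι) →
      1 ≤ (n : ℝ) * (2 ^ l : ℕ) * ∏ i, dn (n * α i)) :
    (((2 ^ l) ^ bohrExponent (Fintype.card ι) : ℕ) : ℝ) ≤ 8 * 2 ^ (∑ i, j i) *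
      ((bohrPos α ((2 ^ l) ^ bohrExponent (Fintype.card ι)) fun i =>
        ((2 : ℝ) ^ j i)⁻¹).filter fun n =>
          primeRecipSum n ≤ recipBound (Fintype.card ι)).card := by
  have hdiv := fun (p : ℕ) hprime hp hpM => mul_card_filter_dvd_le (p := p) α hl j hj hprime hp hpM
    hbad
  have hpig := le_card_bohr_mul α ((2 ^ l) ^ bohrExponent (Fintype.card ι)) j
  set R := Fintype.card ι with hR
  set E := bohrExponent R with hE
  set M := 2 ^ l with hM
  set δ : ι → ℝ := fun i => ((2 : ℝ) ^ j i)⁻¹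
  set B := bohr α ((M ^ E : ℕ) : ℝ) δ
  set A := bohrPos α (M ^ E) δ
  set C := 90 ^ (R + 1) with hC
  have hM2 : 2 ≤ M := by
    calc 2 = 2 ^ 1 := rfl
      _ ≤ 2 ^ l := Nat.pow_le_pow_right (by norm_num) hl
  have hB4 : 4 ≤ B.card := by
    have h1 : 2 ^ ∑ i, j i ≤ M ^ R := by
      rw [hM, ← pow_mul]
      refine Nat.pow_le_pow_right (by norm_num) ?_
      calc ∑ i, j i ≤ ∑ _i : ι, l := Finset.sum_le_sum fun i _ => hj i
        _ = l * R := by simp [← hR, mul_comm]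
    have h2 : 4 * M ^ R ≤ M ^ E := by
      calc 4 * M ^ R ≤ M ^ 2 * M ^ R := by gcongr; nlinarith
        _ = M ^ (2 + R) := by rw [pow_add]
        _ ≤ M ^ E := Nat.pow_le_pow_right (by omega) (by rw [hE, bohrExponent]; omega)
    have h3 : 4 * M ^ R ≤ B.card * M ^ R :=
      h2.trans (hpig.trans (Nat.mul_le_mul_left _ h1))
    exact Nat.le_of_mul_le_mul_right h3 (by positivity)
  set P := (Finset.Ioo (C - 1) (M + 1)).filter Nat.Prime with hP
  set mid : ℕ → ℝ := fun n => ∑ p ∈ P, if p ∣ n then (p : ℝ)⁻¹ else 0 with hmid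
  have hmid0 : ∀ n, 0 ≤ mid n := fun n => Finset.sum_nonneg fun p _ => by split_ifs <;> positivity
  have hmidsum : ∑ n ∈ A, mid n ≤ B.card / 9 := by
    calc ∑ n ∈ A, mid n = ∑ p ∈ P, (p : ℝ)⁻¹ * (A.filter fun n => p ∣ n).card := by
          rw [hmid, Finset.sum_comm]
          refine Finset.sum_congr rfl fun p _ => ?_
          rw [← Finset.sum_filter, Finset.sum_const, nsmul_eq_mul, mul_comm]
      _ ≤ ∑ p ∈ P, 5 ^ (R + 1) * B.card * ((p : ℝ) ^ 2)⁻¹ := by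
          refine Finset.sum_le_sum fun p hp => ?_
          rw [hP, Finset.mem_filter, Finset.mem_Ioo] at hp
          have hCp : C ≤ p := by omega
          have h9 : 9 ^ (R + 1) ≤ p := le_trans (by rw [hC]; gcongr; norm_num) hCp
          have h1 := hdiv p hp.2 h9 (by omega)
          have h2 : (p : ℝ) * (A.filter fun n => p ∣ n).card ≤ 5 ^ (R + 1) * B.card := by
            exact_mod_cast (Nat.mul_le_mul_left p (card_filter_dvd_bohrPos_le α _ δ p)).trans h1
          have hpR : (0 : ℝ) < p := by exact_mod_cast hp.2.pos
          calc (p : ℝ)⁻¹ * (A.filter fun n => p ∣ n).card =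
                (p * (A.filter fun n => p ∣ n).card) * ((p : ℝ) ^ 2)⁻¹ := by field_simp
            _ ≤ _ := by gcongr
      _ = 5 ^ (R + 1) * B.card * ∑ p ∈ P, ((p : ℝ) ^ 2)⁻¹ := by rw [Finset.mul_sum]
      _ ≤ 5 ^ (R + 1) * B.card * ∑ p ∈ Finset.Ioo (C - 1) (M + 1), ((p : ℝ) ^ 2)⁻¹ := by
          gcongr
          exact Finset.filter_subset _ _
      _ ≤ 5 ^ (R + 1) * B.card * (2 / ((C - 1 : ℕ) + 1)) := by
          gcongr
          exact sum_Ioo_inv_sq_le _ _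
      _ = 2 * B.card / 18 ^ (R + 1) := by
          have : ((C - 1 : ℕ) : ℝ) + 1 = 5 ^ (R + 1) * 18 ^ (R + 1) := by
            have h1 : C - 1 + 1 = C := Nat.sub_add_cancel (Nat.one_le_pow _ _ (by norm_num))
            rw [← mul_pow]
            norm_num
            exact_mod_cast h1
          rw [this]
          field_simp
      _ ≤ 2 * B.card / 18 := by
          gcongr
          exact le_self_pow₀ (by norm_num) (by omega)
      _ = _ := by ring
  have hgood : ∀ n ∈ A, mid n ≤ 1 → primeRecipSum n ≤ recipBound R := by
    intro n hn h
    obtain ⟨⟨h1, h2⟩, -⟩ := mem_bohrPos.1 hn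
    refine (primeRecipSum_le (C := C) (by omega) h1 h2).trans ?_
    have : mid n = ∑ p ∈ (Finset.Ioo (C - 1) (M + 1)).filter fun p => p.Prime ∧ p ∣ n,
        (p : ℝ)⁻¹ := by
      rw [hmid, hP]
      simp only
      rw [← Finset.sum_filter, Finset.filter_filter]
    rw [← this, recipBound]
    push_cast
    rw [hC] at *
    push_cast
    linarith
  have hbadcard : ((A.filter fun n => ¬ primeRecipSum n ≤ recipBound R).card : ℝ) ≤
      B.card / 9 := by
    refine le_trans ?_ hmidsum
    calc _ = ∑ n ∈ A.filter fun n => ¬ primeRecipSum n ≤ recipBound R, (1 : ℝ) := by simp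
      _ ≤ ∑ n ∈ A.filter fun n => ¬ primeRecipSum n ≤ recipBound R, mid n := by
          refine Finset.sum_le_sum fun n hn => ?_
          rw [Finset.mem_filter] at hn
          by_contra! h
          exact hn.2 (hgood n hn.1 h.le)
      _ ≤ _ := Finset.sum_le_sum_of_subset_of_nonneg (Finset.filter_subset _ _)
          fun n _ _ => hmid0 n
  have hsplit : ((A.filter fun n => primeRecipSum n ≤ recipBound R).card : ℝ) +
      (A.filter fun n => ¬ primeRecipSum n ≤ recipBound R).card = A.card := by
    exact_mod_cast Finset.card_filter_add_card_filter_not _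
  have hAB : (B.card : ℝ) ≤ 2 * (A.card + 1) := by
    exact_mod_cast card_bohr_le_two_mul α (M ^ E) δ
  have hB4R : (4 : ℝ) ≤ B.card := by exact_mod_cast hB4
  have hfin : (B.card : ℝ) ≤ 8 * (A.filter fun n => primeRecipSum n ≤ recipBound R).card := by
    linarith
  calc ((M ^ E : ℕ) : ℝ) ≤ B.card * 2 ^ ∑ i, j i := by exact_mod_cast hpig
    _ ≤ (8 * (A.filter fun n => primeRecipSum n ≤ recipBound R).card) * 2 ^ ∑ i, j i := by gcongr
    _ = _ := by ring

lemma sum_range_ite_two_pow_le {d : ℝ} (hd : 0 < d) (l : ℕ) :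
    (∑ j ∈ Finset.range l, if d ≤ ((2 : ℝ) ^ j)⁻¹ then (2 : ℝ) ^ j else 0) ≤ 2 * d⁻¹ := by
  induction l with
  | zero => simpa using hd.le
  | succ l ih =>
    rw [Finset.sum_range_succ]
    split_ifs with h
    · have h1 : (∑ j ∈ Finset.range l, if d ≤ ((2 : ℝ) ^ j)⁻¹ then (2 : ℝ) ^ j else 0) ≤
          ∑ j ∈ Finset.range l, (2 : ℝ) ^ j :=
        Finset.sum_le_sum fun j _ => by split_ifs <;> [rfl; positivity]
      have h2 : ∑ j ∈ Finset.range l, (2 : ℝ) ^ j = 2 ^ l - 1 := by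
        rw [geom_sum_eq (by norm_num)]
        norm_num
      have h3 : (2 : ℝ) ^ l ≤ d⁻¹ := (le_inv_comm₀ hd (by positivity)).1 h
      linarith
    · simpa using ih

open Classical in
lemma le_sum_prod_inv_dn (α : ι → ℝ) {l : ℕ} (hl : 1 ≤ l)
    (hbad : ∀ n : ℕ, 1 ≤ n → n ≤ (2 ^ l) ^ bohrExponent (Fintype.card ι) →
      1 ≤ (n : ℝ) * (2 ^ l : ℕ) * ∏ i, dn (n * α i)) :
    (((2 ^ l) ^ bohrExponent (Fintype.card ι) : ℕ) : ℝ) * (l + 1) ^ Fintype.card ι ≤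
      8 * 2 ^ Fintype.card ι *
        ∑ n ∈ (Finset.Icc 1 ((2 ^ l) ^ bohrExponent (Fintype.card ι))).filter
          (fun n => primeRecipSum n ≤ recipBound (Fintype.card ι)), ∏ i, (dn (n * α i))⁻¹ := by
  set R := Fintype.card ι with hR
  set N := (2 ^ l) ^ bohrExponent R with hN
  set G := (Finset.Icc 1 N).filter fun n => primeRecipSum n ≤ recipBound R with hG
  have hpos : ∀ n ∈ G, ∀ i, 0 < dn (n * α i) := by
    intro n hn i
    rw [hG, Finset.mem_filter, Finset.mem_Icc] at hn
    refine (dn_nonneg _).lt_of_ne fun h => ?_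
    have h1 := hbad n hn.1.1 hn.1.2
    rw [Finset.prod_eq_zero (Finset.mem_univ i) h.symm, mul_zero] at h1
    linarith
  set J := Fintype.piFinset fun _ : ι => Finset.range (l + 1) with hJ
  have hJcard : J.card = (l + 1) ^ R := by
    rw [hJ, Fintype.card_piFinset]
    simp [hR]
  have hcount : ∀ j ∈ J, (N : ℝ) ≤ 8 * ∑ n ∈ G,
      ∏ i, if dn (n * α i) ≤ ((2 : ℝ) ^ j i)⁻¹ then (2 : ℝ) ^ j i else 0 := by
    intro j hj
    have hj' : ∀ i, j i ≤ l := fun i => by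
      have := Fintype.mem_piFinset.1 hj i
      rw [Finset.mem_range] at this
      omega
    refine (card_bohr_le_eight_mul α hl j hj' hbad).trans_eq ?_
    have h1 : (bohrPos α N fun i => ((2 : ℝ) ^ j i)⁻¹).filter
        (fun n => primeRecipSum n ≤ recipBound R) =
        G.filter fun n : ℕ => ∀ i, dn (n * α i) ≤ ((2 : ℝ) ^ j i)⁻¹ := by
      ext n
      simp only [hG, Finset.mem_filter, mem_bohrPos, Finset.mem_Icc]
      tauto
    simp only [← hR, ← hN, h1, Finset.prod_ite_zero, Finset.mem_univ, forall_const]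
    rw [← Finset.sum_filter, Finset.sum_const, nsmul_eq_mul, Finset.prod_pow_eq_pow_sum]
    ring
  calc (N : ℝ) * (l + 1) ^ R = ∑ j ∈ J, (N : ℝ) := by
        rw [Finset.sum_const, hJcard, nsmul_eq_mul]
        push_cast
        ring
    _ ≤ ∑ j ∈ J, 8 * ∑ n ∈ G,
        ∏ i, if dn (n * α i) ≤ ((2 : ℝ) ^ j i)⁻¹ then (2 : ℝ) ^ j i else 0 :=
      Finset.sum_le_sum hcount
    _ = 8 * ∑ n ∈ G, ∏ i, ∑ j ∈ Finset.range (l + 1),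
        if dn (n * α i) ≤ ((2 : ℝ) ^ j)⁻¹ then (2 : ℝ) ^ j else 0 := by
      rw [← Finset.mul_sum, Finset.sum_comm]
      congr 1
      refine Finset.sum_congr rfl fun n _ => ?_
      rw [Finset.prod_univ_sum]
    _ ≤ 8 * ∑ n ∈ G, ∏ i, 2 * (dn (n * α i))⁻¹ := by
      refine mul_le_mul_of_nonneg_left (Finset.sum_le_sum fun n hn => ?_) (by norm_num)
      refine Finset.prod_le_prod (fun i _ => Finset.sum_nonneg fun j _ => ?_) fun i _ =>
        sum_range_ite_two_pow_le (hpos n hn i) _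
      split_ifs <;> positivity
    _ = _ := by
      rw [mul_assoc, Finset.mul_sum (a := (2 : ℝ) ^ R)]
      congr 1
      refine Finset.sum_congr rfl fun n _ => ?_
      rw [Finset.prod_mul_distrib, Finset.prod_const, Finset.card_univ]

end Bohr

lemma sum_range_ite_inv_le {B : ℕ → ℝ} (hB : ∀ m, 0 < B m) (hB2 : ∀ m, 2 * B m ≤ B (m + 1))
    {x : ℝ} (hx : 0 < x) (L : ℕ) :
    (∑ m ∈ Finset.range L, if x ≤ B m then (B m)⁻¹ else 0) ≤ 2 * x⁻¹ := by
  have key : (∑ m ∈ Finset.range L, if x ≤ B m then (B m)⁻¹ else 0) ≤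
      2 * (x⁻¹ - min x⁻¹ (B L)⁻¹) := by
    induction L with
    | zero => simp
    | succ L ih =>
      rw [Finset.sum_range_succ]
      have hstep : (B (L + 1))⁻¹ ≤ (B L)⁻¹ / 2 := by
        calc (B (L + 1))⁻¹ ≤ (2 * B L)⁻¹ := inv_anti₀ (by linarith [hB L]) (hB2 L)
          _ = _ := by rw [mul_inv]; ring
      split_ifs with h
      · have h1 : (B L)⁻¹ ≤ x⁻¹ := inv_anti₀ hx h
        rw [min_eq_right h1] at ih
        have := min_le_right x⁻¹ (B (L + 1))⁻¹
        linarith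
      · have h1 : x⁻¹ ≤ (B L)⁻¹ := inv_anti₀ (hB L) (not_le.1 h).le
        rw [min_eq_left h1] at ih
        have := min_le_left x⁻¹ (B (L + 1))⁻¹
        linarith
  have : 0 ≤ min x⁻¹ (B L)⁻¹ := le_min (inv_nonneg.2 hx.le) (inv_nonneg.2 (hB L).le)
  linarith

/-- If the partial sums of `f` up to `N` are of order at least `N (log N) ^ R` along the powers of
`2 ^ E`, then `∑ f n / (n (log n) ^ (R + 1))` diverges. -/
lemma not_summable_div_of_le_sum {f : ℕ → ℝ} (hf : ∀ n, 0 ≤ f n) {c : ℝ} (hc : 0 < c)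
    {E R l₀ : ℕ} (hE : 1 ≤ E)
    (h : ∀ l, l₀ ≤ l → c * (((2 ^ l) ^ E : ℕ) * (l + 1) ^ R) ≤
      ∑ n ∈ Finset.Icc 1 ((2 ^ l) ^ E), f n) :
    ¬ Summable fun n : ℕ => f n / (n * (1 + Real.log n) ^ (R + 1)) := by
  intro hs
  set a : ℕ → ℝ := fun n => f n / (n * (1 + Real.log n) ^ (R + 1)) with ha
  have hlog : ∀ n : ℕ, 0 ≤ Real.log n := fun n => Real.log_natCast_nonneg n
  have ha0 : ∀ n, 0 ≤ a n := fun n => by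
    have := hlog n
    have := hf n
    positivity
  set B : ℕ → ℕ := fun m => (2 ^ (l₀ + m)) ^ E with hB
  have hB0 : ∀ m, 0 < B m := fun m => by positivity
  have hBmono : Monotone B := fun m m' hm => by
    simp only [hB]
    gcongr
    norm_num
  have hterm : ∀ m, c / (m + (l₀ + 1 : ℕ)) ≤
      ∑ n ∈ Finset.Icc 1 (B m), a n * E ^ (R + 1) * n * (B m : ℝ)⁻¹ := by
    intro m
    have h1 := h (l₀ + m) (Nat.le_add_right _ _)
    have hBm : (0 : ℝ) < B m := by exact_mod_cast hB0 m
    have hden : (0 : ℝ) < m + (l₀ + 1 : ℕ) := by positivity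
    have h2 : ∑ n ∈ Finset.Icc 1 (B m), f n ≤
        ∑ n ∈ Finset.Icc 1 (B m), a n * E ^ (R + 1) * n * (m + (l₀ + 1 : ℕ) : ℝ) ^ (R + 1) := by
      refine Finset.sum_le_sum fun n hn => ?_
      rw [Finset.mem_Icc] at hn
      have hn0 : (0 : ℝ) < n := by exact_mod_cast hn.1
      have hl1 : 1 + Real.log n ≤ E * (m + (l₀ + 1 : ℕ)) := by
        have h3 : Real.log n ≤ Real.log (B m) :=
          Real.log_le_log hn0 (by exact_mod_cast hn.2)
        have h4 : Real.log (B m) = E * ((l₀ + m) * Real.log 2) := by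
          simp only [hB]
          push_cast
          rw [Real.log_pow, Real.log_pow]
          push_cast
          ring
        have h5 : Real.log 2 ≤ 1 := by
          have := Real.log_two_lt_d9
          linarith
        have h6 : (E : ℝ) * ((l₀ + m) * Real.log 2) ≤ E * ((l₀ + m) * 1) := by gcongr
        have h7 : (1 : ℝ) ≤ E := by exact_mod_cast hE
        push_cast
        linarith
      have hl0 : 0 < 1 + Real.log n := by linarith [hlog n]
      calc f n = a n * n * (1 + Real.log n) ^ (R + 1) := by
            rw [ha]
            field_simp
        _ ≤ a n * n * (E * (m + (l₀ + 1 : ℕ))) ^ (R + 1) := by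
            have := ha0 n
            gcongr
        _ = _ := by rw [mul_pow]; ring
    rw [← Finset.sum_mul] at h2 ⊢
    rw [div_le_iff₀ hden, ← div_eq_mul_inv, div_mul_eq_mul_div, le_div_iff₀ hBm]
    have h3 : c * (B m * (m + (l₀ + 1 : ℕ) : ℝ) ^ R) ≤
        (∑ n ∈ Finset.Icc 1 (B m), a n * E ^ (R + 1) * n) *
          (m + (l₀ + 1 : ℕ) : ℝ) ^ (R + 1) := by
      refine le_trans (le_of_eq ?_) (h1.trans h2)
      simp only [hB]
      push_cast
      ring
    refine le_of_mul_le_mul_right ?_ (pow_pos hden R)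
    calc _ = c * (B m * (m + (l₀ + 1 : ℕ) : ℝ) ^ R) := by ring
      _ ≤ _ := h3
      _ = _ := by ring
  have hbound : ∀ L, ∑ m ∈ Finset.range L, c / ((m : ℝ) + (l₀ + 1 : ℕ)) ≤
      E ^ (R + 1) * 2 * ∑' n, a n := by
    intro L
    calc _ ≤ ∑ m ∈ Finset.range L, ∑ n ∈ Finset.Icc 1 (B m),
          a n * E ^ (R + 1) * n * (B m : ℝ)⁻¹ := Finset.sum_le_sum fun m _ => hterm m
      _ = ∑ m ∈ Finset.range L, ∑ n ∈ Finset.Icc 1 (B L),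
          a n * E ^ (R + 1) * n * (if (n : ℝ) ≤ B m then (B m : ℝ)⁻¹ else 0) := by
          refine Finset.sum_congr rfl fun m hm => ?_
          have hle : B m ≤ B L := hBmono (Finset.mem_range.1 hm).le
          simp only [mul_ite, mul_zero, Nat.cast_le]
          rw [← Finset.sum_filter]
          refine Finset.sum_congr ?_ fun _ _ => rfl
          ext n
          simp only [Finset.mem_filter, Finset.mem_Icc]
          omega
      _ = ∑ n ∈ Finset.Icc 1 (B L), a n * E ^ (R + 1) * n *
          ∑ m ∈ Finset.range L, (if (n : ℝ) ≤ B m then (B m : ℝ)⁻¹ else 0) := by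
          rw [Finset.sum_comm]
          simp only [Finset.mul_sum]
      _ ≤ ∑ n ∈ Finset.Icc 1 (B L), a n * E ^ (R + 1) * n * (2 * (n : ℝ)⁻¹) := by
          refine Finset.sum_le_sum fun n hn => ?_
          have hn0 : (0 : ℝ) < n := by exact_mod_cast (Finset.mem_Icc.1 hn).1
          refine mul_le_mul_of_nonneg_left (sum_range_ite_inv_le (B := fun m => (B m : ℝ))
            (fun m => by exact_mod_cast hB0 m) (fun m => ?_) hn0 L) ?_
          · have : 2 * B m ≤ B (m + 1) := by
              simp only [hB, ← pow_mul]
              rw [← pow_succ']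
              refine Nat.pow_le_pow_right (by norm_num) ?_
              nlinarith
            exact_mod_cast this
          · have := ha0 n
            positivity
      _ = E ^ (R + 1) * 2 * ∑ n ∈ Finset.Icc 1 (B L), a n := by
          rw [Finset.mul_sum]
          refine Finset.sum_congr rfl fun n hn => ?_
          have hn0 : (n : ℝ) ≠ 0 := by exact_mod_cast (Nat.pos_iff_ne_zero.1 (Finset.mem_Icc.1 hn).1)
          field_simp
      _ ≤ _ := by
          gcongr
          exact hs.sum_le_tsum _ fun n _ => ha0 n
  have hsum := summable_of_sum_range_le (fun m => by positivity) hbound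
  have hsum2 : Summable fun m : ℕ => (((m + (l₀ + 1) : ℕ) : ℝ))⁻¹ := by
    refine (hsum.mul_left c⁻¹).congr fun m => ?_
    push_cast
    field_simp
  exact Real.not_summable_natCast_inv ((summable_nat_add_iff (l₀ + 1)).1 hsum2)

lemma exists_forall_pow_le_mul_two_pow {c : ℝ} (hc : 0 < c) (E k : ℕ) :
    ∃ l₀ : ℕ, 1 ≤ l₀ ∧ ∀ l, l₀ ≤ l → (1 + E * l : ℝ) ^ k ≤ c * 2 ^ l := by
  have h := tendsto_pow_const_div_const_pow_of_one_lt k (one_lt_two (α := ℝ))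
  have hc' : 0 < c / (1 + E) ^ k := by positivity
  obtain ⟨l₀, hl₀⟩ := eventually_atTop.1 (h.eventually (gt_mem_nhds hc'))
  refine ⟨max l₀ 1, le_max_right _ _, fun l hl => ?_⟩
  have h1 : (1 : ℝ) ≤ l := by exact_mod_cast (le_max_right _ _).trans hl
  have h2 := hl₀ l ((le_max_left _ _).trans hl)
  rw [div_lt_div_iff₀ (by positivity) (by positivity)] at h2
  calc (1 + E * l : ℝ) ^ k ≤ ((1 + E) * l) ^ k := by
        gcongr
        nlinarith [(Nat.cast_nonneg E : (0 : ℝ) ≤ E)]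
    _ = (l : ℝ) ^ k * (1 + E) ^ k := by rw [mul_pow]; ring
    _ ≤ _ := h2.le

open Classical in
lemma ae_frequently_mul_dn_lt {ι : Type*} [Fintype ι] (α : ι → ℝ) {c : ℝ} (hc : 0 < c)
    (h : ∀ n : ℕ, 1 ≤ n →
      c ≤ n * (1 + Real.log n) ^ (Fintype.card ι + 1) * ∏ i, dn (n * α i))
    {ε : ℝ} (hε : 0 < ε) :
    ∀ᵐ x : ℝ, ∃ᶠ n : ℕ in atTop,
      n * (1 + Real.log n) ^ (Fintype.card ι + 1) * ((∏ i, dn (n * α i)) * dn (n * x)) < ε := by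
  set R := Fintype.card ι with hR
  set f : ℕ → ℝ := fun n =>
    if primeRecipSum n ≤ recipBound R then ∏ i, (dn (n * α i))⁻¹ else 0 with hf
  set a : ℕ → ℝ := fun n => f n / (n * (1 + Real.log n) ^ (R + 1)) with ha
  have hf0 : ∀ n, 0 ≤ f n := fun n => by
    simp only [hf]
    split_ifs
    · exact Finset.prod_nonneg fun i _ => inv_nonneg.2 (dn_nonneg _)
    · rfl
  have hlog : ∀ n : ℕ, 0 ≤ Real.log n := fun n => Real.log_natCast_nonneg n
  have ha0 : ∀ n, 0 ≤ a n := fun n => by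
    have := hlog n
    have := hf0 n
    positivity
  have ha1 : ∀ n, 1 ≤ n → primeRecipSum n ≤ recipBound R →
      a n = (n * (1 + Real.log n) ^ (R + 1) * ∏ i, dn (n * α i))⁻¹ := by
    intro n _ hn
    simp only [ha, hf, if_pos hn]
    rw [Finset.prod_inv_distrib, mul_inv, div_eq_mul_inv, mul_comm]
  have hac : ∀ n, a n ≤ c⁻¹ := by
    intro n
    rcases Nat.eq_zero_or_pos n with rfl | hn
    · simp only [ha, Nat.cast_zero, zero_mul, div_zero]
      positivity
    by_cases hp : primeRecipSum n ≤ recipBound R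
    · rw [ha1 n hn hp]
      exact inv_anti₀ hc (h n hn)
    · simp only [ha, hf, if_neg hp, zero_div]
      positivity
  obtain ⟨l₀, hl₀1, hl₀⟩ := exists_forall_pow_le_mul_two_pow hc (bohrExponent R) (R + 1)
  have hns : ¬ Summable a := by
    refine not_summable_div_of_le_sum (c := (8 * 2 ^ R)⁻¹) (E := bohrExponent R) (l₀ := l₀) hf0
      (by positivity) (by rw [bohrExponent]; omega) fun l hl => ?_
    have h1 := le_sum_prod_inv_dn α (hl₀1.trans hl) fun n hn1 hnN => ?_
    · rw [inv_mul_le_iff₀ (by positivity)]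
      simp only [hf]
      rw [← Finset.sum_filter]
      exact h1
    · have hn0 : (0 : ℝ) < n := by exact_mod_cast hn1
      have h2 : 1 + Real.log n ≤ 1 + bohrExponent R * l := by
        have h3 : Real.log n ≤ Real.log (((2 ^ l) ^ bohrExponent R : ℕ) : ℝ) :=
          Real.log_le_log hn0 (by exact_mod_cast hnN)
        push_cast at h3
        rw [Real.log_pow, Real.log_pow] at h3
        have h5 : Real.log 2 ≤ 1 := by
          have := Real.log_two_lt_d9
          linarith
        have h6 : (bohrExponent R : ℝ) * (l * Real.log 2) ≤ bohrExponent R * (l * 1) := by gcongr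
        linarith
      have h7 : 0 ≤ 1 + Real.log n := by linarith [hlog n]
      have h8 : (1 + Real.log n) ^ (R + 1) ≤ c * 2 ^ l := by
        refine le_trans ?_ (hl₀ l hl)
        gcongr
      have h9 : 0 ≤ ∏ i, dn (n * α i) := Finset.prod_nonneg fun i _ => dn_nonneg _
      refine le_of_mul_le_mul_left ?_ hc
      calc c * 1 ≤ n * (1 + Real.log n) ^ (R + 1) * ∏ i, dn (n * α i) := by
            rw [mul_one]
            exact h n hn1
        _ ≤ n * (c * 2 ^ l) * ∏ i, dn (n * α i) := by gcongr
        _ = _ := by push_cast; ring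
  set η := min ε (c / 2) with hη
  have hη0 : 0 < η := lt_min hε (by positivity)
  have hmain := ae_frequently_dn_lt (ψ := fun n => η * a n)
    (κ := Real.exp (-2 * recipBound R)) (Real.exp_pos _) (fun n => mul_nonneg hη0.le (ha0 n))
    (fun n => ?_) (fun n hn => ?_) (by simp [ha]) (fun hs => hns ?_)
  · filter_upwards [hmain] with x hx
    refine hx.mono fun n hn => ?_
    have hψ : 0 < η * a n := (dn_nonneg _).trans_lt hn
    have hn1 : 1 ≤ n := by
      refine Nat.pos_of_ne_zero fun h0 => ?_
      rw [h0] at hψ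
      simp [ha] at hψ
    have hp : primeRecipSum n ≤ recipBound R := by
      by_contra hp
      simp [ha, hf, hp] at hψ
    rw [ha1 n hn1 hp] at hn
    have hD := hc.trans_le (h n hn1)
    rw [← div_eq_mul_inv, lt_div_iff₀ hD] at hn
    calc _ = dn (n * x) * (n * (1 + Real.log n) ^ (R + 1) * ∏ i, dn (n * α i)) := by ring
      _ < η := hn
      _ ≤ ε := min_le_left _ _
  · calc η * a n ≤ (c / 2) * c⁻¹ := by
          gcongr
          · exact ha0 n
          · exact min_le_right _ _
          · exact hac n
      _ = 1 / 2 := by field_simp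
  · refine exp_neg_mul_le_totient ?_
    by_contra hp
    simp [ha, hf, hp] at hn
  · exact (summable_mul_left_iff hη0.ne').1 hs

lemma liminf_eq_zero_of_frequently_lt {f : ℕ → ℝ} (h0 : ∀ n, 0 ≤ f n)
    (h : ∀ ε > 0, ∃ᶠ n in atTop, f n < ε) : Filter.liminf f atTop = 0 := by
  have hle : ∀ a, (∀ᶠ n in atTop, a ≤ f n) → a ≤ 0 := by
    intro a ha
    by_contra! h1
    obtain ⟨n, hn, hn'⟩ := ((h a h1).and_eventually ha).exists
    linarith
  rw [Filter.liminf_eq]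
  exact le_antisymm (csSup_le ⟨0, Eventually.of_forall h0⟩ hle)
    (le_csSup ⟨0, hle⟩ (Eventually.of_forall h0))

lemma exists_forall_le_mul_prod_dn {ι : Type*} [Fintype ι] (α : ι → ℝ) {k : ℕ} {ε : ℝ}
    (hε : 0 < ε)
    (h : ∀ᶠ n : ℕ in atTop, ε ≤ n * Real.log n ^ k * ∏ i, dn (n * α i)) :
    ∃ c > 0, ∀ n : ℕ, 1 ≤ n → c ≤ n * (1 + Real.log n) ^ k * ∏ i, dn (n * α i) := by
  have hlog : ∀ n : ℕ, 0 ≤ Real.log n := fun n => Real.log_natCast_nonneg n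
  obtain ⟨n₀, hn₀⟩ := eventually_atTop.1 h
  set g : ℕ → ℝ := fun n => n * (1 + Real.log n) ^ k * ∏ i, dn (n * α i) with hg
  have hlarge : ∀ n, n₀ ≤ n → ε ≤ g n := by
    intro n hn
    refine (hn₀ n hn).trans ?_
    have h1 : 0 ≤ ∏ i, dn (n * α i) := Finset.prod_nonneg fun i _ => dn_nonneg _
    have h2 := hlog n
    simp only [hg]
    gcongr
    linarith
  have hpos : ∀ n, 1 ≤ n → 0 < g n := by
    intro n hn
    have h2 := hlog n
    have hn0 : (0 : ℝ) < n := by exact_mod_cast hn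
    refine mul_pos (by positivity) (Finset.prod_pos fun i _ => (dn_nonneg _).lt_of_ne fun h0 => ?_)
    have h3 := hlarge ((n₀ + 1) * n) (by nlinarith)
    have h4 : dn (((n₀ + 1) * n : ℕ) * α i) = 0 := by
      refine le_antisymm ?_ (dn_nonneg _)
      have := dn_natCast_mul_le (n₀ + 1) (n * α i)
      rw [← h0, mul_zero, ← mul_assoc] at this
      exact_mod_cast this
    simp only [hg] at h3
    rw [Finset.prod_eq_zero (Finset.mem_univ i) h4, mul_zero] at h3
    linarith
  obtain ⟨m, hm, hmin⟩ := (Finset.Icc 1 (n₀ + 1)).exists_min_image g ⟨1, by simp⟩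
  refine ⟨min ε (g m), lt_min hε (hpos m (Finset.mem_Icc.1 hm).1), fun n hn => ?_⟩
  rcases le_total n n₀ with h1 | h1
  · exact (min_le_right _ _).trans (hmin n (Finset.mem_Icc.2 ⟨hn, by omega⟩))
  · exact (min_le_left _ _).trans (hlarge n h1)

/-- Fibre refinement of Gallagher's theorem: for `k ≥ 2` and any
`α₁, …, α_{k-1} ∈ ℝ`, for almost every `α_k ∈ ℝ` we have
`liminf_{n→∞} n (log n)^k ‖nα₁‖ ⋯ ‖nα_k‖ = 0`. -/
theorem gallagher_fibre (k : ℕ) (hk : 2 ≤ k) (α : Fin (k - 1) → ℝ) :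
    ∀ᵐ αk : ℝ ∂(volume : Measure ℝ),
      Filter.liminf
        (fun n : ℕ => (n : ℝ) * Real.log n ^ k * ((∏ i, dn (n * α i)) * dn (n * αk)))
        Filter.atTop = 0 := by
  have hlog : ∀ n : ℕ, 0 ≤ Real.log n := fun n => Real.log_natCast_nonneg n
  have hprod : ∀ n : ℕ, 0 ≤ ∏ i, dn (n * α i) := fun n =>
    Finset.prod_nonneg fun i _ => dn_nonneg _
  have hnonneg : ∀ (x : ℝ) (n : ℕ),
      0 ≤ (n : ℝ) * Real.log n ^ k * ((∏ i, dn (n * α i)) * dn (n * x)) := fun x n => by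
    have := hlog n
    have := hprod n
    have := dn_nonneg (n * x)
    positivity
  by_cases hcase : ∀ ε > 0, ∃ᶠ n : ℕ in atTop, n * Real.log n ^ k * ∏ i, dn (n * α i) < ε
  · refine Eventually.of_forall fun x => liminf_eq_zero_of_frequently_lt (hnonneg x) fun ε hε =>
      (hcase ε hε).mono fun n hn => lt_of_le_of_lt ?_ hn
    have := hlog n
    refine mul_le_mul_of_nonneg_left (mul_le_of_le_one_right (hprod n) ?_) (by positivity)
    linarith [dn_le_half (n * x)]
  · push Not at hcase
    obtain ⟨ε₀, hε₀, hev⟩ := hcase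
    obtain ⟨c, hc, hcn⟩ := exists_forall_le_mul_prod_dn α hε₀ hev
    have hcard : Fintype.card (Fin (k - 1)) + 1 = k := by
      rw [Fintype.card_fin]
      omega
    have hall : ∀ᵐ x : ℝ, ∀ m : ℕ, ∃ᶠ n : ℕ in atTop,
        n * (1 + Real.log n) ^ k * ((∏ i, dn (n * α i)) * dn (n * x)) < 1 / ((m : ℝ) + 1) := by
      refine ae_all_iff.2 fun m => ?_
      have := ae_frequently_mul_dn_lt α hc (by rwa [hcard]) (ε := 1 / ((m : ℝ) + 1))
        (by positivity)
      rwa [hcard] at this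
    filter_upwards [hall] with x hx
    refine liminf_eq_zero_of_frequently_lt (hnonneg x) fun ε hε => ?_
    obtain ⟨m, hm⟩ := exists_nat_one_div_lt hε
    refine (hx m).mono fun n hn => lt_of_le_of_lt ?_ (hn.trans hm)
    have h1 := hlog n
    have h2 := mul_nonneg (hprod n) (dn_nonneg (n * x))
    gcongr
    linarith
end

section
/- Let k ≥ 3 be an integer and let α = (α_1, …, α_{k−1}) ∈ ℝ^{k−1} satisfy ω^×(α) ≥ (k−1)/(k−2). Then there exist arbitrarily large n ∈ ℕ with ‖nα_1‖ ⋯ ‖nα_{k−1}‖ < n^{−1 − 1/(k−1)}, and consequently for every α_k ∈ ℝ we have liminf_{n→∞} n (log n)^k ‖nα_1‖ ⋯ ‖nα_k‖ = 0. -/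
open scoped BigOperators
open Filter MeasureTheory

/-- Multiplicative exponent `ω^×(α)`: the supremum of the set of real numbers `w` such
that `‖nα₁‖⋯‖nα_d‖ < n^{-w}` holds for infinitely many `n ∈ ℕ`. -/
noncomputable def multExp {d : ℕ} (α : Fin d → ℝ) : EReal :=
  sSup {w : EReal | ∃ v : ℝ, w = (v : ℝ) ∧
    {n : ℕ | 0 < n ∧ ∏ i, dn (n * α i) < (n : ℝ) ^ (-v)}.Infinite}

/-- The distance to the nearest integer is at most `1`. -/
lemma dn_le_one (x : ℝ) : dn x ≤ 1 :=
  (abs_sub_round x).trans (by norm_num)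

/-- Every real number below the multiplicative exponent is attained at arbitrarily large `n`. -/
lemma exists_prod_dn_lt_of_lt_multExp {d : ℕ} {α : Fin d → ℝ} {w : ℝ}
    (hw : (w : EReal) < multExp α) (N : ℕ) :
    ∃ n : ℕ, N ≤ n ∧ 0 < n ∧ ∏ i, dn (n * α i) < (n : ℝ) ^ (-w) := by
  obtain ⟨_, ⟨v, rfl, hv⟩, hwv⟩ := lt_sSup_iff.mp hw
  obtain ⟨n, ⟨hn0, hn⟩, hNn⟩ := hv.exists_gt N
  refine ⟨n, hNn.le, hn0, hn.trans_le ?_⟩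
  exact Real.rpow_le_rpow_of_exponent_le (by exact_mod_cast hn0)
    (neg_le_neg (EReal.coe_lt_coe_iff.mp hwv).le)

/-- A nonnegative real sequence that is frequently below every positive number has liminf `0`. -/
lemma liminf_eq_zero_of_frequently_le {f : ℕ → ℝ} (h0 : ∀ n, 0 ≤ f n)
    (hf : ∀ ε > 0, ∃ᶠ n in atTop, f n ≤ ε) : liminf f atTop = 0 := by
  refine le_antisymm (le_of_forall_pos_le_add fun ε hε => ?_) ?_
  · rw [zero_add]
    exact liminf_le_of_frequently_le (hf ε hε) ⟨0, eventually_map.2 (.of_forall h0)⟩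
  · refine le_liminf_of_le ?_ (.of_forall h0)
    exact IsCobounded.of_frequently_le (hf 1 one_pos)

/-- `log n ^ k * n ^ (-c)` tends to `0` for `c > 0`. -/
lemma tendsto_log_pow_mul_rpow_neg (k : ℕ) {c : ℝ} (hc : 0 < c) :
    Tendsto (fun n : ℕ => Real.log n ^ k * (n : ℝ) ^ (-c)) atTop (nhds 0) := by
  have h := (isLittleO_log_rpow_rpow_atTop (k : ℝ) hc).tendsto_div_nhds_zero.comp
    tendsto_natCast_atTop_atTop
  refine h.congr fun n => ?_
  simp only [Function.comp_apply, Real.rpow_natCast, Real.rpow_neg (Nat.cast_nonneg n),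
    div_eq_mul_inv]

/-- If `k ≥ 3` and `ω^×(α) ≥ (k-1)/(k-2)` then there are arbitrarily large `n` with
`‖nα₁‖⋯‖nα_{k-1}‖ < n^{-1-1/(k-1)}`, and consequently for every `α_k ∈ ℝ` the liminf
`liminf n (log n)^k ‖nα₁‖⋯‖nα_k‖` is `0`. -/
theorem large_mult_exponent_case (k : ℕ) (hk : 3 ≤ k) (α : Fin (k - 1) → ℝ)
    (hα : ((((k : ℝ) - 1) / ((k : ℝ) - 2) : ℝ) : EReal) ≤ multExp α) :
    (∀ N : ℕ, ∃ n : ℕ, N ≤ n ∧ 0 < n ∧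
      ∏ i, dn (n * α i) < (n : ℝ) ^ (-(1 + 1 / ((k : ℝ) - 1)))) ∧
    ∀ αk : ℝ,
      Filter.liminf
        (fun n : ℕ => (n : ℝ) * Real.log n ^ k * ((∏ i, dn (n * α i)) * dn (n * αk)))
        Filter.atTop = 0 := by
  have hk' : (3 : ℝ) ≤ k := by exact_mod_cast hk
  have hc : 0 < 1 / ((k : ℝ) - 1) := one_div_pos.2 (by linarith)
  have hlt : 1 + 1 / ((k : ℝ) - 1) < ((k : ℝ) - 1) / ((k : ℝ) - 2) := by
    have h1 : 1 / ((k : ℝ) - 1) < 1 / ((k : ℝ) - 2) :=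
      one_div_lt_one_div_of_lt (by linarith) (by linarith)
    have h2 : ((k : ℝ) - 1) / ((k : ℝ) - 2) = 1 + 1 / ((k : ℝ) - 2) := by
      have : (k : ℝ) - 2 ≠ 0 := by linarith
      field_simp
      ring
    rw [h2]
    gcongr
  have key := exists_prod_dn_lt_of_lt_multExp ((EReal.coe_lt_coe_iff.2 hlt).trans_le hα)
  refine ⟨key, fun αk => liminf_eq_zero_of_frequently_le (fun n => ?_) fun ε hε => ?_⟩
  · exact mul_nonneg (mul_nonneg n.cast_nonneg (pow_nonneg (Real.log_natCast_nonneg n) k))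
      (mul_nonneg (Finset.prod_nonneg fun i _ => dn_nonneg _) (dn_nonneg _))
  · obtain ⟨M, hM⟩ := eventually_atTop.1
      ((tendsto_log_pow_mul_rpow_neg k hc).eventually_le_const hε)
    refine frequently_atTop.2 fun N => ?_
    obtain ⟨n, hn, hn0, hprod⟩ := key (max N M)
    refine ⟨n, (le_max_left _ _).trans hn, ?_⟩
    have hnpos : (0 : ℝ) < n := by exact_mod_cast hn0
    have hlog : 0 ≤ Real.log n := Real.log_natCast_nonneg n
    calc (n : ℝ) * Real.log n ^ k * ((∏ i, dn (n * α i)) * dn (n * αk))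
        ≤ (n : ℝ) * Real.log n ^ k * ((n : ℝ) ^ (-(1 + 1 / ((k : ℝ) - 1))) * 1) := by
          gcongr
          · exact dn_nonneg _
          · exact dn_le_one _
      _ = Real.log n ^ k * (n : ℝ) ^ (-(1 / ((k : ℝ) - 1))) := by
          rw [neg_add, Real.rpow_add hnpos, Real.rpow_neg_one]
          field_simp
      _ ≤ ε := hM n ((le_max_right _ _).trans hn)
end
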